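/- Let N ≥ 3. There exists a constant C > 0 depending only on N such that for all u₁, u₂, φ ∈ C²_c(ℝ^N), |∫_{ℝ^N} (det(D²u₁) − det(D²u₂)) φ dx| ≤ C ‖u₁ − u₂‖_{2−2/N, N} (‖u₁‖_{2−2/N, N}^{N−1} + ‖u₂‖_{2−2/N, N}^{N−1}) ‖D²φ‖_{L^∞(ℝ^N)}, where ‖D²φ‖_{L^∞(ℝ^N)} is the supremum over x of the norm of the Hessian matrix of φ. -/

import Mathlib

open MeasureTheory Real Filter

noncomputable section

abbrev Eu (N : ℕ) : Type := EuclideanSpace ℝ (Fin N)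

def ebasis {N : ℕ} (i : Fin N) : Eu N := EuclideanSpace.single i 1

/-- Partial derivative `∂ᵢ u (x)`. -/
def pd {N : ℕ} (u : Eu N → ℝ) (i : Fin N) (x : Eu N) : ℝ :=
  fderiv ℝ u x (ebasis i)

/-- Second partial derivative `∂ᵢ∂ⱼ u (x)`. -/
def pd2 {N : ℕ} (u : Eu N → ℝ) (i j : Fin N) (x : Eu N) : ℝ :=
  fderiv ℝ (fun y => fderiv ℝ u y (ebasis j)) x (ebasis i)

/-- The determinant of the Hessian matrix `det (D²u)(x)`. -/
def hessDet {N : ℕ} (u : Eu N → ℝ) (x : Eu N) : ℝ :=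
  (Matrix.of fun i j => pd2 u i j x).det

/-- The Besov norm `‖u‖_{s,p}`. -/
def besov (N : ℕ) (s p : ℝ) (u : Eu N → ℝ) : ℝ :=
  (∫ x : Eu N, |u x| ^ p) ^ (1/p)
  + (∫ x : Eu N, ‖fderiv ℝ u x‖ ^ p) ^ (1/p)
  + (∫ x : Eu N, ∫ y : Eu N,
      ‖fderiv ℝ u x - fderiv ℝ u y‖ ^ p / ‖x - y‖ ^ ((N : ℝ) + (s-1)*p)) ^ (1/p)

section Part1
open scoped ContDiff

lemma pd2_eq {N : ℕ} (u : Eu N → ℝ) (i j : Fin N) : pd2 u i j = pd (pd u j) i := rfl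

lemma contDiff_pd {N : ℕ} {u : Eu N → ℝ} {n m : WithTop ℕ∞} (hu : ContDiff ℝ n u)
    (h : m + 1 ≤ n) (i : Fin N) : ContDiff ℝ m (pd u i) := by
  have := hu.fderiv_right h
  exact this.clm_apply contDiff_const

lemma hcs_pd {N : ℕ} {u : Eu N → ℝ} (hu : HasCompactSupport u)
    (i : Fin N) : HasCompactSupport (pd u i) := by
  have := hu.fderiv (𝕜 := ℝ)
  exact this.comp_left (g := fun L : Eu N →L[ℝ] ℝ => L (ebasis i)) (by simp)

lemma pd_comm {N : ℕ} {u : Eu N → ℝ} (hu : ContDiff ℝ 2 u) (i j : Fin N) :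
    pd (pd u j) i = pd (pd u i) j := by
  funext x
  have hs : IsSymmSndFDerivAt ℝ u x := hu.contDiffAt.isSymmSndFDerivAt (by simp)
  have hd : DifferentiableAt ℝ (fderiv ℝ u) x :=
    (hu.fderiv_right (m := 1) (by norm_num)).differentiable (by norm_num) x
  have key : ∀ v w : Eu N, fderiv ℝ (fun y => fderiv ℝ u y v) x w = fderiv ℝ (fderiv ℝ u) x w v := by
    intro v w
    rw [fderiv_clm_apply hd (by fun_prop)]
    simp
  change fderiv ℝ (fun y => fderiv ℝ u y (ebasis j)) x (ebasis i) =
    fderiv ℝ (fun y => fderiv ℝ u y (ebasis i)) x (ebasis j)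
  rw [key, key]
  exact hs.eq _ _

lemma ibp_pd {N : ℕ} {f g : Eu N → ℝ} (hf : ContDiff ℝ 1 f) (hfc : HasCompactSupport f)
    (hg : ContDiff ℝ 1 g) (i : Fin N) :
    ∫ x, f x * pd g i x = - ∫ x, pd f i x * g x := by
  have hf' := (contDiff_pd hf (m := 0) (by norm_num) i).continuous
  have hg' := (contDiff_pd hg (m := 0) (by norm_num) i).continuous
  refine integral_mul_fderiv_eq_neg_fderiv_mul_of_integrable ?_ ?_ ?_ ?_ ?_
  · exact (hf'.mul hg.continuous).integrable_of_hasCompactSupport ((hcs_pd hfc i).mul_right)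
  · exact (hf.continuous.mul hg').integrable_of_hasCompactSupport (hfc.mul_right)
  · exact (hf.continuous.mul hg.continuous).integrable_of_hasCompactSupport (hfc.mul_right)
  · intro x _; exact hf.differentiable (by norm_num) x
  · intro x _; exact hg.differentiable (by norm_num) x

lemma pd_mul {N : ℕ} {f g : Eu N → ℝ} (hf : ContDiff ℝ 1 f)
    (hg : ContDiff ℝ 1 g) (i : Fin N) (x : Eu N) :
    pd (fun y => f y * g y) i x = pd f i x * g x + f x * pd g i x := by
  unfold pd
  rw [fderiv_fun_mul (hf.differentiable (by norm_num) x) (hg.differentiable (by norm_num) x)]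
  simp; ring

lemma pd_prod {N : ℕ} {ι : Type*} [DecidableEq ι] (S : Finset ι) {f : ι → Eu N → ℝ}
    (hf : ∀ i, ContDiff ℝ 1 (f i)) (i : Fin N) (x : Eu N) :
    pd (fun y => ∏ j ∈ S, f j y) i x = ∑ l ∈ S, pd (f l) i x * ∏ j ∈ S.erase l, f j x := by
  unfold pd
  rw [fderiv_finsetProd (fun j _ => (hf j).differentiable (by norm_num) x)]
  simp [mul_comm]

/-- the product with the `k`-th factor removed -/
def dropProd {N : ℕ} (H : Fin N → Fin N → ℝ) (k : Fin N) (σ : Equiv.Perm (Fin N)) : ℝ :=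
  ∏ j ∈ Finset.univ.erase k, H (σ j) j

lemma swap_sum {N : ℕ} (H : Fin N → Fin N → ℝ) (k l : Fin N) (hkl : l ≠ k)
    (F : Fin N → Fin N → ℝ) :
    ∑ σ : Equiv.Perm (Fin N), ((Equiv.Perm.sign σ : ℤ) : ℝ) *
      (F (σ k) (σ l) * ∏ j ∈ (Finset.univ.erase k).erase l, H (σ j) j) =
    - ∑ σ : Equiv.Perm (Fin N), ((Equiv.Perm.sign σ : ℤ) : ℝ) *
      (F (σ l) (σ k) * ∏ j ∈ (Finset.univ.erase k).erase l, H (σ j) j) := by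
  rw [← Finset.sum_neg_distrib]
  refine Fintype.sum_equiv (Equiv.mulRight (Equiv.swap k l)) _ _ ?_
  intro σ
  simp only [Equiv.coe_mulRight, Equiv.Perm.sign_mul, Equiv.Perm.sign_swap hkl.symm,
    Equiv.Perm.mul_apply, Equiv.swap_apply_left, Equiv.swap_apply_right]
  have : ∏ j ∈ (Finset.univ.erase k).erase l, H (σ (Equiv.swap k l j)) j =
      ∏ j ∈ (Finset.univ.erase k).erase l, H (σ j) j := by
    refine Finset.prod_congr rfl ?_
    intro j hj
    simp only [Finset.mem_erase, Finset.mem_univ, and_true] at hj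
    rw [Equiv.swap_apply_of_ne_of_ne hj.2 hj.1]
  rw [this]
  push_cast
  ring

lemma alg_a {N : ℕ} (T : Fin N → Fin N → Fin N → ℝ) (H : Fin N → Fin N → ℝ)
    (hT : ∀ a b c, T a b c = T b a c) (k : Fin N) :
    ∑ σ : Equiv.Perm (Fin N), ((Equiv.Perm.sign σ : ℤ) : ℝ) *
      ∑ l ∈ Finset.univ.erase k, T (σ k) (σ l) l *
        ∏ j ∈ (Finset.univ.erase k).erase l, H (σ j) j = 0 := by
  simp_rw [Finset.mul_sum]
  rw [Finset.sum_comm]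
  refine Finset.sum_eq_zero ?_
  intro l hl
  have h := swap_sum H k l (Finset.ne_of_mem_erase hl)
    (fun a b => T a b l)
  simp_rw [fun a b => hT a b l] at h
  have h2 := swap_sum H k l (Finset.ne_of_mem_erase hl)
    (fun a b => T a b l)
  have e : ∀ σ : Equiv.Perm (Fin N), T (σ l) (σ k) l = T (σ k) (σ l) l := fun σ => hT _ _ _
  simp_rw [e] at h2
  linarith

lemma alg_b {N : ℕ} (a : Fin N → ℝ) (T : Fin N → Fin N → Fin N → ℝ) (H : Fin N → Fin N → ℝ)
    (hT : ∀ a b c, T a b c = T c b a) :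
    ∑ k, ∑ σ : Equiv.Perm (Fin N), ((Equiv.Perm.sign σ : ℤ) : ℝ) *
      (a (σ k) * ∑ l ∈ Finset.univ.erase k, T k (σ l) l *
        ∏ j ∈ (Finset.univ.erase k).erase l, H (σ j) j) = 0 := by
  set S : Fin N → Fin N → ℝ := fun k l => if l = k then 0 else
    ∑ σ : Equiv.Perm (Fin N), ((Equiv.Perm.sign σ : ℤ) : ℝ) *
      ((a (σ k) * T k (σ l) l) * ∏ j ∈ (Finset.univ.erase k).erase l, H (σ j) j) with hS
  have hanti : ∀ k l, S k l = - S l k := by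
    intro k l
    by_cases h : l = k
    · simp [hS, h]
    · have h' : ¬ k = l := fun e => h e.symm
      simp only [hS, h, h', if_false]
      rw [swap_sum H k l h (fun x y => a x * T k y l)]
      congr 1
      refine Finset.sum_congr rfl ?_
      intro σ _
      rw [Finset.erase_right_comm, hT k]
  have e1 : ∀ k, ∑ σ : Equiv.Perm (Fin N), ((Equiv.Perm.sign σ : ℤ) : ℝ) *
      (a (σ k) * ∑ l ∈ Finset.univ.erase k, T k (σ l) l *
        ∏ j ∈ (Finset.univ.erase k).erase l, H (σ j) j) = ∑ l, S k l := by
    intro k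
    simp_rw [Finset.mul_sum]
    rw [Finset.sum_comm]
    rw [← Finset.add_sum_erase Finset.univ (fun l => S k l) (Finset.mem_univ k)]
    have : S k k = 0 := by simp [hS]
    rw [this, zero_add]
    refine Finset.sum_congr rfl ?_
    intro l hl
    have h := Finset.ne_of_mem_erase hl
    simp only [hS, h, if_false]
    refine Finset.sum_congr rfl ?_
    intro σ _
    ring
  simp_rw [e1]
  have h1 : ∑ k, ∑ l, S k l = ∑ k, ∑ l, S l k := Finset.sum_comm
  have h2 : ∑ k, ∑ l, S k l = - ∑ k, ∑ l, S l k := by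
    simp_rw [← Finset.sum_neg_distrib]
    exact Finset.sum_congr rfl fun k _ => Finset.sum_congr rfl fun l _ => hanti k l
  linarith

lemma space_ibp {N : ℕ} {W Q φ : Eu N → ℝ} (hW : ContDiff ℝ ∞ W) (hQ : ContDiff ℝ ∞ Q)
    (hφ : ContDiff ℝ 2 φ) (hφc : HasCompactSupport φ) :
    ∑ k, ∑ σ : Equiv.Perm (Fin N), ((Equiv.Perm.sign σ : ℤ) : ℝ) *
      ∫ x, φ x * dropProd (fun i j => pd2 W i j x) k σ * pd2 Q (σ k) k x =
    ∑ k, ∑ σ : Equiv.Perm (Fin N), ((Equiv.Perm.sign σ : ℤ) : ℝ) *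
      ∫ x, pd2 φ k (σ k) x * dropProd (fun i j => pd2 W i j x) k σ * Q x := by
  have hW1 : ∀ j, ContDiff ℝ ∞ (pd W j) := fun j => contDiff_pd hW (by simp) j
  have hW2 : ∀ i j, ContDiff ℝ ∞ (pd2 W i j) := fun i j => contDiff_pd (hW1 j) (by simp) i
  have hW3 : ∀ a i j, ContDiff ℝ ∞ (pd (pd2 W i j) a) := fun a i j => contDiff_pd (hW2 i j) (by simp) a
  have hQ1 : ∀ j, ContDiff ℝ ∞ (pd Q j) := fun j => contDiff_pd hQ (by simp) j
  have hφ1 : ∀ j, ContDiff ℝ 1 (pd φ j) := fun j => contDiff_pd hφ (by norm_num) j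
  have hφ2 : ∀ i j, ContDiff ℝ 0 (pd2 φ i j) := fun i j => contDiff_pd (hφ1 j) (by norm_num) i
  have h1 : (1 : WithTop ℕ∞) ≤ ∞ := by simp
  set P : Fin N → Equiv.Perm (Fin N) → Eu N → ℝ := fun k σ x =>
    dropProd (fun i j => pd2 W i j x) k σ with hP
  have hPs : ∀ k σ, ContDiff ℝ 1 (P k σ) := by
    intro k σ
    simp only [hP, dropProd]
    exact contDiff_prod fun j _ => (hW2 _ _).of_le h1
  have hPd : ∀ k σ a x, pd (P k σ) a x = ∑ l ∈ Finset.univ.erase k, pd (pd2 W (σ l) l) a x *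
        ∏ j ∈ (Finset.univ.erase k).erase l, pd2 W (σ j) j x := by
    intro k σ a x
    exact pd_prod (Finset.univ.erase k) (f := fun j => pd2 W (σ j) j)
      (fun j => (hW2 _ _).of_le h1) a x
  have hPdc : ∀ k σ a, Continuous (pd (P k σ) a) := fun k σ a =>
    (contDiff_pd (hPs k σ) (m := 0) (by norm_num) a).continuous
  have le2 : (2 : WithTop ℕ∞) ≤ ∞ := by
    exact WithTop.coe_le_coe.2 (le_top : (2 : ℕ∞) ≤ ⊤)
  have sym1 : ∀ a b c x, pd (pd2 W b c) a x = pd (pd2 W a c) b x := by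
    intro a b c x
    have := pd_comm ((hW1 c).of_le le2) a b
    exact congrFun this x
  have sym2 : ∀ a b c x, pd (pd2 W b c) a x = pd (pd2 W b a) c x := by
    intro a b c x
    have e : pd2 W b c = pd2 W c b := pd_comm (hW.of_le le2) b c
    have e' : pd2 W b a = pd2 W a b := pd_comm (hW.of_le le2) b a
    rw [e, e']
    exact congrFun (pd_comm ((hW1 b).of_le le2) a c) x
  have step1 : ∀ k σ, ∫ x, φ x * P k σ x * pd2 Q (σ k) k x =
      - (∫ x, pd φ (σ k) x * P k σ x * pd Q k x) - ∫ x, φ x * pd (P k σ) (σ k) x * pd Q k x := by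
    intro k σ
    have hfs : ContDiff ℝ 1 (fun x => φ x * P k σ x) := (hφ.of_le (by norm_num)).mul (hPs k σ)
    have := ibp_pd hfs hφc.mul_right ((hQ1 k).of_le h1) (σ k)
    rw [pd2_eq, this, ← neg_add', ← integral_add]
    · congr 1
      refine integral_congr_ae (Eventually.of_forall fun x => ?_)
      simp only
      rw [pd_mul (hφ.of_le (by norm_num)) (hPs k σ)]
      ring
    · exact (((hφ1 _).continuous.mul (hPs k σ).continuous).mul
        (hQ1 k).continuous).integrable_of_hasCompactSupport ((hcs_pd hφc _).mul_right.mul_right)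
    · exact ((hφ.continuous.mul (hPdc k σ _)).mul
        (hQ1 k).continuous).integrable_of_hasCompactSupport (hφc.mul_right.mul_right)
  have step2 : ∀ k σ, ∫ x, pd φ (σ k) x * P k σ x * pd Q k x =
      - (∫ x, pd2 φ k (σ k) x * P k σ x * Q x) - ∫ x, pd φ (σ k) x * pd (P k σ) k x * Q x := by
    intro k σ
    have hfs : ContDiff ℝ 1 (fun x => pd φ (σ k) x * P k σ x) := (hφ1 _).mul (hPs k σ)
    have := ibp_pd hfs (hcs_pd hφc _).mul_right (hQ.of_le h1) k
    rw [this, ← neg_add', ← integral_add]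
    · congr 1
      refine integral_congr_ae (Eventually.of_forall fun x => ?_)
      simp only
      rw [pd_mul (hφ1 _) (hPs k σ), pd2_eq]
      ring
    · exact (((hφ2 _ _).continuous.mul (hPs k σ).continuous).mul
        hQ.continuous).integrable_of_hasCompactSupport
          ((hcs_pd (hcs_pd hφc _) _).mul_right.mul_right)
    · exact (((hφ1 _).continuous.mul (hPdc k σ _)).mul
        hQ.continuous).integrable_of_hasCompactSupport ((hcs_pd hφc _).mul_right.mul_right)
  have van1 : ∀ k, ∑ σ : Equiv.Perm (Fin N), ((Equiv.Perm.sign σ : ℤ) : ℝ) *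
      ∫ x, φ x * pd (P k σ) (σ k) x * pd Q k x = 0 := by
    intro k
    simp_rw [← integral_const_mul]
    rw [← integral_finsetSum]
    · rw [← integral_zero (Eu N) ℝ]
      refine integral_congr_ae (Eventually.of_forall fun x => ?_)
      simp only [hPd]
      have := alg_a (fun a b c => pd (pd2 W b c) a x) (fun i j => pd2 W i j x)
        (fun a b c => sym1 a b c x) k
      have h2 := congrArg (fun t => φ x * pd Q k x * t) this
      simp only [mul_zero] at h2
      refine Eq.trans ?_ h2
      rw [Finset.mul_sum]
      refine Finset.sum_congr rfl fun σ _ => ?_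
      ring
    · intro σ _
      exact (((hφ.continuous.mul (hPdc k σ _)).mul
        (hQ1 k).continuous).integrable_of_hasCompactSupport (hφc.mul_right.mul_right)).const_mul _
  have van2 : ∑ k, ∑ σ : Equiv.Perm (Fin N), ((Equiv.Perm.sign σ : ℤ) : ℝ) *
      ∫ x, pd φ (σ k) x * pd (P k σ) k x * Q x = 0 := by
    have hInt : ∀ k (σ : Equiv.Perm (Fin N)), Integrable (fun x => ((Equiv.Perm.sign σ : ℤ) : ℝ) *
        (pd φ (σ k) x * pd (P k σ) k x * Q x)) := by
      intro k σ
      exact ((((hφ1 _).continuous.mul (hPdc k σ _)).mul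
        hQ.continuous).integrable_of_hasCompactSupport
          ((hcs_pd hφc _).mul_right.mul_right)).const_mul _
    simp_rw [← integral_const_mul]
    have : ∀ k, ∑ σ : Equiv.Perm (Fin N), ∫ x, ((Equiv.Perm.sign σ : ℤ) : ℝ) *
        (pd φ (σ k) x * pd (P k σ) k x * Q x) =
        ∫ x, ∑ σ : Equiv.Perm (Fin N), ((Equiv.Perm.sign σ : ℤ) : ℝ) *
        (pd φ (σ k) x * pd (P k σ) k x * Q x) := by
      intro k
      rw [integral_finsetSum]
      intro σ _; exact hInt k σ
    simp_rw [this]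
    rw [← integral_finsetSum]
    · rw [← integral_zero (Eu N) ℝ]
      refine integral_congr_ae (Eventually.of_forall fun x => ?_)
      simp only [hPd]
      have := alg_b (fun a => pd φ a x) (fun a b c => pd (pd2 W b c) a x) (fun i j => pd2 W i j x)
        (fun a b c => sym2 a b c x)
      have h2 := congrArg (fun t => Q x * t) this
      simp only [mul_zero] at h2
      refine Eq.trans ?_ h2
      rw [Finset.mul_sum]
      refine Finset.sum_congr rfl fun k _ => ?_
      rw [Finset.mul_sum]
      refine Finset.sum_congr rfl fun σ _ => ?_
      ring
    · intro k _
      exact integrable_finsetSum _ fun σ _ => hInt k σ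
  have fin : ∀ k, ∑ σ : Equiv.Perm (Fin N), ((Equiv.Perm.sign σ : ℤ) : ℝ) *
      ∫ x, φ x * P k σ x * pd2 Q (σ k) k x =
      ∑ σ : Equiv.Perm (Fin N), ((Equiv.Perm.sign σ : ℤ) : ℝ) *
      (∫ x, pd2 φ k (σ k) x * P k σ x * Q x) +
      ∑ σ : Equiv.Perm (Fin N), ((Equiv.Perm.sign σ : ℤ) : ℝ) *
      ∫ x, pd φ (σ k) x * pd (P k σ) k x * Q x := by
    intro k
    rw [← sub_zero (∑ σ : Equiv.Perm (Fin N), ((Equiv.Perm.sign σ : ℤ) : ℝ) *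
      (∫ x, pd2 φ k (σ k) x * P k σ x * Q x) + _), ← van1 k, ← Finset.sum_add_distrib,
      ← Finset.sum_sub_distrib]
    refine Finset.sum_congr rfl fun σ _ => ?_
    rw [step1, step2]
    ring
  rw [Finset.sum_congr rfl fun k _ => fin k, Finset.sum_add_distrib, van2, add_zero]

end Part1

section Part2
open scoped ContDiff

/-- spatial partial derivative on `ℝ × Eu N` -/
def dx {N : ℕ} (f : ℝ × Eu N → ℝ) (i : Fin N) (p : ℝ × Eu N) : ℝ := fderiv ℝ f p (0, ebasis i)

/-- scale derivative on `ℝ × Eu N` -/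
def dscale {N : ℕ} (f : ℝ × Eu N → ℝ) (p : ℝ × Eu N) : ℝ := fderiv ℝ f p (1, 0)

lemma contDiff_dx {N : ℕ} {f : ℝ × Eu N → ℝ} (hf : ContDiff ℝ ∞ f) (i : Fin N) :
    ContDiff ℝ ∞ (dx f i) :=
  (hf.fderiv_right (m := ∞) (by simp)).clm_apply contDiff_const

lemma contDiff_dscale {N : ℕ} {f : ℝ × Eu N → ℝ} (hf : ContDiff ℝ ∞ f) :
    ContDiff ℝ ∞ (dscale f) :=
  (hf.fderiv_right (m := ∞) (by simp)).clm_apply contDiff_const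

lemma dscale_dx {N : ℕ} {f : ℝ × Eu N → ℝ} (hf : ContDiff ℝ ∞ f) (i : Fin N) :
    dscale (dx f i) = dx (dscale f) i := by
  funext x
  have hs : IsSymmSndFDerivAt ℝ f x := hf.contDiffAt.isSymmSndFDerivAt
    (by simpa using WithTop.coe_le_coe.2 (le_top : (2 : ℕ∞) ≤ ⊤))
  have hd : DifferentiableAt ℝ (fderiv ℝ f) x :=
    (hf.fderiv_right (m := 1) (WithTop.coe_le_coe.2 (le_top : (1 + 1 : ℕ∞) ≤ ⊤))).differentiable
      (by norm_num) x
  have key : ∀ v w : ℝ × Eu N,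
      fderiv ℝ (fun y => fderiv ℝ f y v) x w = fderiv ℝ (fderiv ℝ f) x w v := by
    intro v w
    rw [fderiv_clm_apply hd (by fun_prop)]
    simp
  change fderiv ℝ (fun y => fderiv ℝ f y _) x _ = fderiv ℝ (fun y => fderiv ℝ f y _) x _
  rw [key, key]
  exact hs.eq _ _

lemma slice_contDiff {N : ℕ} {f : ℝ × Eu N → ℝ} (hf : ContDiff ℝ ∞ f) (s : ℝ) :
    ContDiff ℝ ∞ (fun x => f (s, x)) := hf.comp (by fun_prop)

lemma slice_pd {N : ℕ} {f : ℝ × Eu N → ℝ} (hf : ContDiff ℝ ∞ f) (s : ℝ) (i : Fin N) :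
    pd (fun x => f (s, x)) i = fun x => dx f i (s, x) := by
  funext x
  have h1 : HasFDerivAt f (fderiv ℝ f (s, x)) (s, x) :=
    (hf.differentiable (by simp) _).hasFDerivAt
  have h2 : HasFDerivAt (fun y : Eu N => (s, y)) (ContinuousLinearMap.inr ℝ ℝ (Eu N)) x :=
    hasFDerivAt_prodMk_right s x
  have h3 := (h1.comp x h2).fderiv
  have h3' : fderiv ℝ (fun y => f (s, y)) x =
    (fderiv ℝ f (s, x)).comp (ContinuousLinearMap.inr ℝ ℝ (Eu N)) := h3
  simp [pd, dx, h3']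

lemma slice_pd2 {N : ℕ} {f : ℝ × Eu N → ℝ} (hf : ContDiff ℝ ∞ f) (s : ℝ) (i j : Fin N) (x : Eu N) :
    pd2 (fun x => f (s, x)) i j x = dx (dx f j) i (s, x) := by
  rw [pd2_eq, slice_pd hf, slice_pd (contDiff_dx hf j)]

lemma slice_deriv {N : ℕ} {f : ℝ × Eu N → ℝ} (hf : ContDiff ℝ ∞ f) (s : ℝ) (x : Eu N) :
    HasDerivAt (fun t => f (t, x)) (dscale f (s, x)) s := by
  have h1 : HasFDerivAt f (fderiv ℝ f (s, x)) (s, x) :=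
    (hf.differentiable (by simp) _).hasFDerivAt
  have h2 : HasFDerivAt (fun y : ℝ => (y, x)) (ContinuousLinearMap.inl ℝ ℝ (Eu N)) s :=
    hasFDerivAt_prodMk_left s x
  have h3 := (h1.comp s h2).hasDerivAt
  simpa [dscale, Function.comp_def] using h3

lemma det_sum {N : ℕ} (u : Eu N → ℝ) (x : Eu N) : hessDet u x =
    ∑ σ : Equiv.Perm (Fin N), ((Equiv.Perm.sign σ : ℤ) : ℝ) * ∏ j, pd2 u (σ j) j x := by
  rw [hessDet, Matrix.det_apply]
  refine Finset.sum_congr rfl fun σ _ => ?_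
  simp [Units.smul_def]

/-- the integrand after integrating by parts -/
def Jint {N : ℕ} (f : ℝ × Eu N → ℝ) (φ : Eu N → ℝ) (s : ℝ) (x : Eu N) : ℝ :=
  ∑ k, ∑ σ : Equiv.Perm (Fin N), ((Equiv.Perm.sign σ : ℤ) : ℝ) *
    (pd2 φ k (σ k) x * dropProd (fun i j => dx (dx f j) i (s, x)) k σ * dscale f (s, x))

/-- the scale derivative of the Hessian determinant -/
def Dint {N : ℕ} (f : ℝ × Eu N → ℝ) (s : ℝ) (x : Eu N) : ℝ :=
  ∑ σ : Equiv.Perm (Fin N), ((Equiv.Perm.sign σ : ℤ) : ℝ) *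
    ∑ k, dropProd (fun i j => dx (dx f j) i (s, x)) k σ * dx (dx (dscale f) k) (σ k) (s, x)

lemma continuous_dropProd {N : ℕ} {f : ℝ × Eu N → ℝ} (hf : ContDiff ℝ ∞ f) (k : Fin N)
    (σ : Equiv.Perm (Fin N)) :
    Continuous (fun p : ℝ × Eu N => dropProd (fun i j => dx (dx f j) i p) k σ) := by
  unfold dropProd
  exact continuous_finsetProd _ fun j _ => (contDiff_dx (contDiff_dx hf _) _).continuous

lemma continuous_Dint {N : ℕ} {f : ℝ × Eu N → ℝ} (hf : ContDiff ℝ ∞ f) :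
    Continuous (fun p : ℝ × Eu N => Dint f p.1 p.2) := by
  unfold Dint
  refine continuous_finsetSum _ fun σ _ => continuous_const.mul (continuous_finsetSum _ fun k _ => ?_)
  exact (continuous_dropProd hf k σ).mul
    (contDiff_dx (contDiff_dx (contDiff_dscale hf) _) _).continuous

lemma det_hasDerivAt {N : ℕ} {f : ℝ × Eu N → ℝ} (hf : ContDiff ℝ ∞ f) (s : ℝ) (x : Eu N) :
    HasDerivAt (fun t => hessDet (fun y => f (t, y)) x) (Dint f s x) s := by
  simp_rw [det_sum, slice_pd2 hf]
  unfold Dint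
  refine HasDerivAt.fun_sum fun σ _ => ?_
  refine HasDerivAt.const_mul _ ?_
  have := HasDerivAt.fun_finsetProd (u := Finset.univ)
    (f := fun j t => dx (dx f j) (σ j) (t, x))
    (f' := fun j => dscale (dx (dx f j) (σ j)) (s, x)) (x := s)
    (fun j _ => slice_deriv (contDiff_dx (contDiff_dx hf _) _) s x)
  simp only [smul_eq_mul] at this
  have e : ∀ j i, dscale (dx (dx f j) i) = dx (dx (dscale f) j) i := by
    intro j i
    rw [dscale_dx (contDiff_dx hf j), dscale_dx hf]
  simp only [e] at this
  exact this

lemma space_J {N : ℕ} {f : ℝ × Eu N → ℝ} (hf : ContDiff ℝ ∞ f) {φ : Eu N → ℝ}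
    (hφ : ContDiff ℝ 2 φ) (hφc : HasCompactSupport φ) (s : ℝ) :
    ∫ x, φ x * Dint f s x = ∫ x, Jint f φ s x := by
  have key := space_ibp (slice_contDiff hf s) (slice_contDiff (contDiff_dscale hf) s) hφ hφc
  simp only [slice_pd2 hf, slice_pd2 (contDiff_dscale hf)] at key
  have hc : ∀ k σ, Continuous (fun x : Eu N => dropProd (fun i j => dx (dx f j) i (s, x)) k σ) :=
    fun k σ => (continuous_dropProd hf k σ).comp (by fun_prop : Continuous fun x : Eu N => (s, x))
  have hc2 : ∀ i j, Continuous (fun x : Eu N => dx (dx (dscale f) j) i (s, x)) :=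
    fun i j => (contDiff_dx (contDiff_dx (contDiff_dscale hf) _) _).continuous.comp
      (by fun_prop : Continuous fun x : Eu N => (s, x))
  have hc3 : Continuous (fun x : Eu N => dscale f (s, x)) :=
    (contDiff_dscale hf).continuous.comp (by fun_prop : Continuous fun x : Eu N => (s, x))
  have hφ2 : ∀ i j, Continuous (pd2 φ i j) := fun i j =>
    (contDiff_pd (contDiff_pd hφ (m := 1) (by norm_num) j) (m := 0) (by norm_num) i).continuous
  have i1 : ∀ k (σ : Equiv.Perm (Fin N)), Integrable (fun x => ((Equiv.Perm.sign σ : ℤ) : ℝ) *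
      (φ x * dropProd (fun i j => dx (dx f j) i (s, x)) k σ *
        dx (dx (dscale f) k) (σ k) (s, x))) := fun k σ =>
    (((hφ.continuous.mul (hc k σ)).mul (hc2 _ _)).integrable_of_hasCompactSupport
      hφc.mul_right.mul_right).const_mul _
  have i2 : ∀ k (σ : Equiv.Perm (Fin N)), Integrable (fun x => ((Equiv.Perm.sign σ : ℤ) : ℝ) *
      (pd2 φ k (σ k) x * dropProd (fun i j => dx (dx f j) i (s, x)) k σ *
        dscale f (s, x))) := fun k σ =>
    ((((hφ2 _ _).mul (hc k σ)).mul hc3).integrable_of_hasCompactSupport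
      (hcs_pd (hcs_pd hφc _) _).mul_right.mul_right).const_mul _
  have L : ∫ x, φ x * Dint f s x = ∑ k, ∑ σ : Equiv.Perm (Fin N),
      ((Equiv.Perm.sign σ : ℤ) : ℝ) * ∫ x, φ x *
        dropProd (fun i j => dx (dx f j) i (s, x)) k σ * dx (dx (dscale f) k) (σ k) (s, x) := by
    simp_rw [← integral_const_mul]
    have : ∀ k, ∑ σ : Equiv.Perm (Fin N), ∫ x, ((Equiv.Perm.sign σ : ℤ) : ℝ) *
      (φ x * dropProd (fun i j => dx (dx f j) i (s, x)) k σ *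
        dx (dx (dscale f) k) (σ k) (s, x)) = ∫ x, ∑ σ : Equiv.Perm (Fin N),
        ((Equiv.Perm.sign σ : ℤ) : ℝ) *
      (φ x * dropProd (fun i j => dx (dx f j) i (s, x)) k σ *
        dx (dx (dscale f) k) (σ k) (s, x)) := by
      intro k
      rw [integral_finsetSum]
      exact fun σ _ => i1 k σ
    simp_rw [this]
    rw [← integral_finsetSum _ fun k _ => integrable_finsetSum _ fun σ _ => i1 k σ]
    refine integral_congr_ae (Eventually.of_forall fun x => ?_)
    simp only [Dint, Finset.mul_sum]
    rw [Finset.sum_comm]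
    refine Finset.sum_congr rfl fun k _ => Finset.sum_congr rfl fun σ _ => ?_
    ring
  rw [L, key]
  simp_rw [← integral_const_mul]
  unfold Jint
  rw [integral_finsetSum _ fun k _ => integrable_finsetSum _ fun σ _ => i2 k σ]
  refine Finset.sum_congr rfl fun k _ => ?_
  rw [integral_finsetSum _ fun σ _ => i2 k σ]

lemma time_identity {N : ℕ} {f : ℝ × Eu N → ℝ} (hf : ContDiff ℝ ∞ f) {φ : Eu N → ℝ}
    (hφ : ContDiff ℝ 2 φ) (hφc : HasCompactSupport φ) (a b : ℝ) :
    (∫ x, φ x * hessDet (fun y => f (b, y)) x) - ∫ x, φ x * hessDet (fun y => f (a, y)) x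
      = ∫ s in a..b, ∫ x, Jint f φ s x := by
  have hdc : ∀ s, Continuous (fun x => hessDet (fun y => f (s, y)) x) := by
    intro s
    simp_rw [det_sum, slice_pd2 hf]
    refine continuous_finsetSum _ fun σ _ => continuous_const.mul
      (continuous_finsetProd _ fun j _ => ?_)
    exact (contDiff_dx (contDiff_dx hf _) _).continuous.comp
      (by fun_prop : Continuous fun x : Eu N => (s, x))
  simp_rw [← space_J hf hφ hφc]
  rw [← integral_sub]
  rotate_left
  · exact (hφ.continuous.mul (hdc b)).integrable_of_hasCompactSupport hφc.mul_right
  · exact (hφ.continuous.mul (hdc a)).integrable_of_hasCompactSupport hφc.mul_right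
  have hcont : Continuous (fun p : ℝ × Eu N => φ p.2 * Dint f p.1 p.2) :=
    (hφ.continuous.comp continuous_snd).mul (continuous_Dint hf)
  rw [intervalIntegral_integral_swap]
  · refine integral_congr_ae (Eventually.of_forall fun x => ?_)
    simp only
    rw [intervalIntegral.integral_eq_sub_of_hasDerivAt (f := fun t => φ x * hessDet (fun y => f (t, y)) x)]
    · intro t _
      exact (det_hasDerivAt hf t x).const_mul _
    · exact (hcont.comp (by fun_prop : Continuous fun t : ℝ => (t, x))).intervalIntegrable _ _
  · have h1 : IntegrableOn (fun p : ℝ × Eu N => φ p.2 * Dint f p.1 p.2)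
        (Set.uIcc a b ×ˢ tsupport φ) :=
      hcont.continuousOn.integrableOn_compact (isCompact_uIcc.prod hφc)
    have h2 : IntegrableOn (fun p : ℝ × Eu N => φ p.2 * Dint f p.1 p.2)
        (Set.uIoc a b ×ˢ (Set.univ : Set (Eu N))) := by
      refine h1.of_forall_sdiff_eq_zero (measurableSet_uIoc.prod MeasurableSet.univ) ?_
      rintro ⟨t, x⟩ ⟨h, h'⟩
      have : x ∉ tsupport φ := by
        intro hx
        exact h' ⟨Set.uIoc_subset_uIcc h.1, hx⟩
      simp [image_eq_zero_of_notMem_tsupport this]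
    rw [Measure.volume_eq_prod, IntegrableOn, ← Measure.prod_restrict, Measure.restrict_univ] at h2
    exact h2

end Part2

section Part3
open scoped ContDiff Topology

/-- the bump -/
def etaBump (N : ℕ) : ContDiffBump (0 : Eu N) := ⟨1/2, 1, by norm_num, by norm_num⟩

/-- the mollifier -/
def eta {N : ℕ} : Eu N → ℝ := (etaBump N).normed volume

lemma eta_contDiff {N : ℕ} : ContDiff ℝ ∞ (eta (N := N)) := (etaBump N).contDiff_normed

lemma eta_hcs {N : ℕ} : HasCompactSupport (eta (N := N)) := (etaBump N).hasCompactSupport_normed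

lemma eta_int {N : ℕ} : ∫ z, eta (N := N) z = 1 := (etaBump N).integral_normed

lemma eta_neg {N : ℕ} (z : Eu N) : eta (-z) = eta z := (etaBump N).normed_neg z

lemma eta_tsupport {N : ℕ} : tsupport (eta (N := N)) = Metric.closedBall 0 1 :=
  (etaBump N).tsupport_normed_eq

lemma eta_zero {N : ℕ} (z : Eu N) (hz : z ∉ Metric.closedBall (0 : Eu N) 1) : eta z = 0 := by
  rw [← eta_tsupport] at hz
  exact image_eq_zero_of_notMem_tsupport hz

lemma pd_eta_zero {N : ℕ} (i : Fin N) (z : Eu N) (hz : z ∉ Metric.closedBall (0 : Eu N) 1) :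
    pd eta i z = 0 := by
  rw [← eta_tsupport] at hz
  have := fderiv_of_notMem_tsupport (𝕜 := ℝ) hz
  simp [pd, this]

lemma norm_ebasis {N : ℕ} (i : Fin N) : ‖(ebasis i : Eu N)‖ = 1 := by
  simp [ebasis]

lemma eta_bound (N : ℕ) : ∃ M : ℝ, 0 < M ∧ (∀ z : Eu N, |eta z| ≤ M) ∧
    ∀ i, ∀ z : Eu N, |pd eta i z| ≤ M := by
  obtain ⟨A, hA⟩ := eta_hcs.exists_bound_of_continuous (eta_contDiff (N := N)).continuous
  have hc : Continuous (fderiv ℝ (eta (N := N))) := eta_contDiff.continuous_fderiv (by simp)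
  obtain ⟨B, hB⟩ := (eta_hcs (N := N).fderiv (𝕜 := ℝ)).exists_bound_of_continuous hc
  refine ⟨max (max A B) 1, by positivity, fun z => ?_, fun i z => ?_⟩
  · exact (hA z).trans (by simp)
  · have := (fderiv ℝ (eta (N := N)) z).le_opNorm (ebasis i)
    rw [norm_ebasis, mul_one] at this
    exact this.trans ((hB z).trans (by simp))

/-- scale extension -/
def ext {N : ℕ} (u : Eu N → ℝ) (p : ℝ × Eu N) : ℝ := ∫ z, eta z * u (p.2 - exp p.1 • z)

lemma ext_contDiff {N : ℕ} {u : Eu N → ℝ} (hu : Continuous u) : ContDiff ℝ ∞ (ext u) := by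
  set g : ℝ → Eu N → ℝ := fun s h => exp (-s) ^ N * eta (exp (-s) • h) with hg
  have hgs : ContDiff ℝ ∞ (fun p : ℝ × Eu N => g p.1 p.2) := by
    simp only [hg]
    refine ContDiff.mul (by fun_prop) ?_
    exact eta_contDiff.comp (by fun_prop)
  have hconv : ∀ p : ℝ × Eu N, ext u p =
      (convolution u (g p.1) (ContinuousLinearMap.mul ℝ ℝ) volume) p.2 := by
    rintro ⟨s, x⟩
    simp only [convolution, ext, ContinuousLinearMap.mul_apply']
    rw [← integral_sub_left_eq_self (fun t => u t * g s (x - t)) volume x]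
    have := Measure.integral_comp_smul (volume : Measure (Eu N))
      (fun h => u (x - h) * eta (exp (-s) • h)) (exp s)
    simp only [smul_smul, ← Real.exp_add, neg_add_cancel, Real.exp_zero, one_smul] at this
    simp only [hg, sub_sub_cancel]
    calc _ = ∫ z, u (x - exp s • z) * eta z := by simp_rw [mul_comm]
      _ = _ := this
      _ = _ := by
        rw [smul_eq_mul, ← integral_const_mul, abs_of_pos (by positivity)]
        simp only [finrank_euclideanSpace, Fintype.card_fin]
        refine integral_congr_ae (Eventually.of_forall fun z => ?_)
        simp only [Real.exp_neg, inv_pow]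
        ring
  rw [contDiff_iff_contDiffAt]
  rintro ⟨s, x⟩
  have key := contDiffOn_convolution_right_with_param (μ := (volume : Measure (Eu N))) (f := u)
    (n := ⊤) (ContinuousLinearMap.mul ℝ ℝ) (g := g) (s := Set.Iio (s + 1))
    (k := Metric.closedBall 0 (exp (s + 1))) isOpen_Iio (isCompact_closedBall _ _) (by
      intro p h hp hh
      simp only [hg]
      rw [eta_zero, mul_zero]
      simp only [Metric.mem_closedBall, dist_zero_right, not_le, norm_smul, Real.norm_eq_abs,
        Real.abs_exp] at hh ⊢
      have h1 : exp p < ‖h‖ := (Real.exp_lt_exp.2 hp).trans hh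
      calc 1 = exp (-p) * exp p := by rw [← Real.exp_add]; simp
        _ < exp (-p) * ‖h‖ := by gcongr) hu.locallyIntegrable hgs.contDiffOn
  have key2 : ContDiffOn ℝ ∞ (ext u) (Set.Iio (s + 1) ×ˢ Set.univ) :=
    key.congr fun p _ => hconv p
  refine key2.contDiffAt ?_
  exact (isOpen_Iio.prod isOpen_univ).mem_nhds ⟨by simp, trivial⟩

lemma hasDerivAt_param {N : ℕ} {h : Eu N → ℝ} (hh : Continuous h) (hc : HasCompactSupport h)
    {F F' : ℝ → Eu N → ℝ} (hF : ∀ t, Continuous (F t))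
    (hF' : Continuous (fun p : ℝ × Eu N => F' p.1 p.2))
    (hd : ∀ t z, HasDerivAt (fun t => F t z) (F' t z) t) (t : ℝ) :
    HasDerivAt (fun t => ∫ z, h z * F t z) (∫ z, h z * F' t z) t := by
  have hcont : Continuous (fun p : ℝ × Eu N => h p.2 * F' p.1 p.2) := by fun_prop
  obtain ⟨C, hC⟩ := (isCompact_closedBall t 1 |>.prod hc).exists_bound_of_continuousOn
    hcont.continuousOn
  have hF't : Continuous (F' t) := hF'.comp (by fun_prop : Continuous fun z : Eu N => (t, z))
  refine (hasDerivAt_integral_of_dominated_loc_of_deriv_le (s := Metric.closedBall t 1)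
    (bound := (tsupport h).indicator fun _ => C) (F := fun t z => h z * F t z)
    (F' := fun t z => h z * F' t z)
    (Metric.closedBall_mem_nhds t one_pos) ?_ ?_ ?_ ?_ ?_ ?_).2
  · exact Eventually.of_forall fun t => (hh.mul (hF t)).aestronglyMeasurable
  · exact (hh.mul (hF t)).integrable_of_hasCompactSupport hc.mul_right
  · exact (hh.mul hF't).aestronglyMeasurable
  · refine Eventually.of_forall fun z s hs => ?_
    by_cases hz : z ∈ tsupport h
    · rw [Set.indicator_of_mem hz]
      exact hC (s, z) ⟨hs, hz⟩
    · rw [Set.indicator_of_notMem hz, image_eq_zero_of_notMem_tsupport hz]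
      simp
  · rw [integrable_indicator_iff (isClosed_tsupport h).measurableSet]
    exact integrableOn_const hc.measure_lt_top.ne
  · exact Eventually.of_forall fun z s _ => (hd s z).const_mul _

lemma hasDerivAt_comp_line {N : ℕ} {g : Eu N → ℝ} (hg : ContDiff ℝ 1 g) {c : ℝ → Eu N} {c' : Eu N}
    {t : ℝ} (hc : HasDerivAt c c' t) :
    HasDerivAt (fun t => g (c t)) (fderiv ℝ g (c t) c') t :=
  (hg.differentiable (by norm_num) (c t)).hasFDerivAt.comp_hasDerivAt t hc

lemma dx_ext {N : ℕ} {g : Eu N → ℝ} (hg : ContDiff ℝ 1 g) (i : Fin N) :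
    dx (ext g) i = ext (pd g i) := by
  funext p
  obtain ⟨s, x⟩ := p
  have hpd : Continuous (pd g i) := (contDiff_pd hg (m := 0) (by norm_num) i).continuous
  have hgc := hg.continuous
  have h1 := hasDerivAt_param (eta_contDiff (N := N)).continuous eta_hcs
    (F := fun t z => g (x + t • ebasis i - exp s • z))
    (F' := fun t z => pd g i (x + t • ebasis i - exp s • z)) (by fun_prop) (by fun_prop) (by
      intro t z
      refine hasDerivAt_comp_line hg ?_
      have : HasDerivAt (fun t : ℝ => t • (ebasis i : Eu N)) ((1 : ℝ) • ebasis i) t :=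
        (hasDerivAt_id t).smul_const _
      simpa using (this.const_add x).sub_const (exp s • z)) 0
  have h2 : HasDerivAt (fun t : ℝ => ext g ((s, x) + t • ((0 : ℝ), (ebasis i : Eu N))))
      (dx (ext g) i (s, x)) 0 := by
    have hd : HasFDerivAt (ext g) (fderiv ℝ (ext g) (s, x))
      ((s, x) + (0 : ℝ) • ((0 : ℝ), (ebasis i : Eu N))) := by
      rw [zero_smul, add_zero]
      exact ((ext_contDiff hgc).differentiable (by simp) _).hasFDerivAt
    have : HasDerivAt (fun t : ℝ => (s, x) + t • ((0 : ℝ), (ebasis i : Eu N)))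
        ((0 : ℝ), (ebasis i : Eu N)) 0 := by
      have := (hasDerivAt_id (0 : ℝ)).smul_const ((0 : ℝ), (ebasis i : Eu N))
      simpa using this.const_add (s, x)
    exact hd.comp_hasDerivAt 0 this
  have h3 := h2.unique (by simpa [ext] using h1)
  rw [h3]
  simp [ext]

lemma dx_dx_ext {N : ℕ} {u : Eu N → ℝ} (hu : ContDiff ℝ 2 u) (i j : Fin N) :
    dx (dx (ext u) j) i = ext (pd2 u i j) := by
  rw [dx_ext (hu.of_le (by norm_num)), dx_ext (contDiff_pd hu (by norm_num) j)]
  rfl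

lemma ext_pd {N : ℕ} {g : Eu N → ℝ} (hg : ContDiff ℝ 1 g) (i : Fin N) (s : ℝ) (x : Eu N) :
    ext (pd g i) (s, x) = exp (-s) * ∫ z, pd eta i z * g (x - exp s • z) := by
  have hgs : ContDiff ℝ 1 (fun z => g (x - exp s • z)) := hg.comp (by fun_prop)
  have h := ibp_pd (f := eta) (g := fun z => g (x - exp s • z)) (eta_contDiff.of_le (by simp))
    eta_hcs hgs i
  have e : ∀ z, pd (fun z => g (x - exp s • z)) i z = - exp s * pd g i (x - exp s • z) := by
    intro z
    have h1 : HasFDerivAt (fun z : Eu N => x - exp s • z)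
        (-(exp s • ContinuousLinearMap.id ℝ (Eu N))) z := by
      simpa using ((hasFDerivAt_id z).const_smul (exp s)).const_sub x
    have h2 := ((hg.differentiable (by norm_num) (x - exp s • z)).hasFDerivAt.comp z h1).fderiv
    have h3 : fderiv ℝ (fun z => g (x - exp s • z)) z = _ := h2
    unfold pd
    rw [h3]
    simp
  simp only [e] at h
  have h' : ∫ z, eta z * (- exp s * pd g i (x - exp s • z)) = - exp s * ext (pd g i) (s, x) := by
    rw [ext, ← integral_const_mul]
    refine integral_congr_ae (Eventually.of_forall fun z => ?_)
    simp only
    ring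
  rw [h'] at h
  have h4 : exp s * ext (pd g i) (s, x) = ∫ z, pd eta i z * g (x - exp s • z) := by linarith
  rw [← h4, ← mul_assoc, ← Real.exp_add]
  simp

lemma pd_eta_int {N : ℕ} (i : Fin N) : ∫ z, pd (eta (N := N)) i z = 0 := by
  have h := ibp_pd (f := eta) (g := fun _ : Eu N => 1) (eta_contDiff.of_le (by simp))
    eta_hcs contDiff_const i
  simp [pd] at h
  simpa [pd] using h

lemma dscale_ext {N : ℕ} {u : Eu N → ℝ} (hu : ContDiff ℝ 1 u) (s : ℝ) (x : Eu N) :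
    dscale (ext u) (s, x) = - exp s * ∫ z, eta z * fderiv ℝ u (x - exp s • z) z := by
  have hfd : Continuous (fderiv ℝ u) := hu.continuous_fderiv (by norm_num)
  have huc := hu.continuous
  have h1 := hasDerivAt_param (eta_contDiff (N := N)).continuous eta_hcs
    (F := fun t z => u (x - exp t • z))
    (F' := fun t z => fderiv ℝ u (x - exp t • z) (-(exp t • z))) (by fun_prop)
    (by
      refine Continuous.clm_apply (hfd.comp (by fun_prop)) (by fun_prop)) (by
      intro t z
      refine hasDerivAt_comp_line hu ?_
      exact ((Real.hasDerivAt_exp t).smul_const z).const_sub x) s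
  have h2 := slice_deriv (ext_contDiff huc) s x
  have h3 := h2.unique h1
  rw [h3, ← integral_const_mul]
  refine integral_congr_ae (Eventually.of_forall fun z => ?_)
  simp only [map_neg, map_smul, smul_eq_mul]
  ring

lemma eta_odd {N : ℕ} (L : Eu N →L[ℝ] ℝ) : ∫ z, eta z * L z = 0 := by
  have h := integral_neg_eq_self (fun z : Eu N => eta z * L z) volume
  simp only [eta_neg, map_neg, mul_neg, integral_neg] at h
  linarith

end Part3

section Part4
open scoped ContDiff Topology

/-- mean oscillation of the gradient -/
def osc {N : ℕ} (u : Eu N → ℝ) (s : ℝ) (x : Eu N) : ℝ :=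
  ∫ z in Metric.closedBall (0 : Eu N) 1, ‖fderiv ℝ u (x - exp s • z) - fderiv ℝ u x‖

lemma osc_nonneg {N : ℕ} (u : Eu N → ℝ) (s : ℝ) (x : Eu N) : 0 ≤ osc u s x :=
  integral_nonneg fun _ => norm_nonneg _

lemma bound_aux {N : ℕ} {u : Eu N → ℝ} (hu : ContDiff ℝ 1 u) (s : ℝ) (x : Eu N) {q : Eu N → ℝ}
    {M : ℝ} (h0 : ∀ z, z ∉ Metric.closedBall (0 : Eu N) 1 → q z = 0)
    (hq : ∀ z ∈ Metric.closedBall (0 : Eu N) 1,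
      |q z| ≤ M * ‖fderiv ℝ u (x - exp s • z) - fderiv ℝ u x‖) :
    |∫ z, q z| ≤ M * osc u s x := by
  have hfd : Continuous (fderiv ℝ u) := hu.continuous_fderiv (by norm_num)
  have hc : Continuous (fun z => M * ‖fderiv ℝ u (x - exp s • z) - fderiv ℝ u x‖) := by fun_prop
  rw [← setIntegral_eq_integral_of_forall_compl_eq_zero h0, osc, ← integral_const_mul]
  rw [← Real.norm_eq_abs]
  refine norm_integral_le_of_norm_le ?_ ?_
  · exact hc.continuousOn.integrableOn_compact (isCompact_closedBall _ _)
  · exact (ae_restrict_iff' measurableSet_closedBall).2 (Eventually.of_forall hq)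

lemma bound_dxdx {N : ℕ} {u : Eu N → ℝ} (hu : ContDiff ℝ 2 u) {M : ℝ}
    (hM : ∀ i, ∀ z : Eu N, |pd eta i z| ≤ M) (i j : Fin N) (s : ℝ) (x : Eu N) :
    |dx (dx (ext u) j) i (s, x)| ≤ M * exp (-s) * osc u s x := by
  have hg : ContDiff ℝ 1 (pd u j) := contDiff_pd hu (by norm_num) j
  have hgc := hg.continuous
  have hpe : Continuous (pd (eta (N := N)) i) := (contDiff_pd eta_contDiff (m := 0) (by simp) i).continuous
  rw [dx_dx_ext hu, pd2_eq, ext_pd hg, abs_mul, Real.abs_exp]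
  have e : ∫ z, pd eta i z * pd u j (x - exp s • z) =
      ∫ z, pd eta i z * (pd u j (x - exp s • z) - pd u j x) := by
    simp_rw [mul_sub]
    rw [integral_sub, integral_mul_const, pd_eta_int, zero_mul, sub_zero]
    · exact Continuous.integrable_of_hasCompactSupport (by fun_prop) (hcs_pd eta_hcs i).mul_right
    · exact (hpe.integrable_of_hasCompactSupport (hcs_pd eta_hcs i)).mul_const _
  rw [e]
  have := bound_aux (hu.of_le (by norm_num : (1 : WithTop ℕ∞) ≤ 2)) s x (M := M)
    (q := fun z => pd eta i z * (pd u j (x - exp s • z) - pd u j x))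
    (fun z hz => by simp [pd_eta_zero i z hz]) (fun z _ => by
      rw [abs_mul]
      refine mul_le_mul (hM i z) ?_ (abs_nonneg _) ((abs_nonneg _).trans (hM i z))
      have := (fderiv ℝ u (x - exp s • z) - fderiv ℝ u x).le_opNorm (ebasis j)
      rw [norm_ebasis, mul_one] at this
      exact this)
  calc _ ≤ exp (-s) * (M * osc u s x) := by gcongr
    _ = _ := by ring

lemma bound_ds {N : ℕ} {u : Eu N → ℝ} (hu : ContDiff ℝ 2 u) {M : ℝ}
    (hM : ∀ z : Eu N, |eta z| ≤ M) (s : ℝ) (x : Eu N) :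
    |dscale (ext u) (s, x)| ≤ M * exp s * osc u s x := by
  have hu1 : ContDiff ℝ 1 u := hu.of_le (by norm_num)
  have hfd : Continuous (fderiv ℝ u) := hu1.continuous_fderiv (by norm_num)
  have hec := (eta_contDiff (N := N)).continuous
  rw [dscale_ext hu1, abs_mul, abs_neg, Real.abs_exp]
  have e : ∫ z, eta z * fderiv ℝ u (x - exp s • z) z =
      ∫ z, eta z * (fderiv ℝ u (x - exp s • z) - fderiv ℝ u x) z := by
    simp_rw [sub_apply, mul_sub]
    rw [integral_sub, eta_odd, sub_zero]
    · refine Continuous.integrable_of_hasCompactSupport ?_ eta_hcs.mul_right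
      exact hec.mul (Continuous.clm_apply (hfd.comp (by fun_prop)) continuous_id)
    · refine Continuous.integrable_of_hasCompactSupport ?_ eta_hcs.mul_right
      exact hec.mul (by fun_prop)
  rw [e]
  have := bound_aux hu1 s x (M := M)
    (q := fun z => eta z * (fderiv ℝ u (x - exp s • z) - fderiv ℝ u x) z)
    (fun z hz => by simp [eta_zero z hz]) (fun z hz => by
      rw [abs_mul]
      refine mul_le_mul (hM z) ?_ (abs_nonneg _) ((abs_nonneg _).trans (hM z))
      have := (fderiv ℝ u (x - exp s • z) - fderiv ℝ u x).le_opNorm z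
      refine this.trans ?_
      have hz' : ‖z‖ ≤ 1 := by simpa using hz
      exact mul_le_of_le_one_right (norm_nonneg _) hz')
  calc _ ≤ exp s * (M * osc u s x) := by gcongr
    _ = _ := by ring

lemma ext_sub {N : ℕ} {u v : Eu N → ℝ} (hu : Continuous u) (hv : Continuous v) :
    ext (fun x => u x - v x) = fun p => ext u p - ext v p := by
  have hec := (eta_contDiff (N := N)).continuous
  funext p
  simp only [ext, mul_sub]
  rw [integral_sub]
  · exact Continuous.integrable_of_hasCompactSupport (by fun_prop) eta_hcs.mul_right
  · exact Continuous.integrable_of_hasCompactSupport (by fun_prop) eta_hcs.mul_right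

lemma dx_sub {N : ℕ} {f g : ℝ × Eu N → ℝ} (hf : ContDiff ℝ ∞ f) (hg : ContDiff ℝ ∞ g) (i : Fin N) :
    dx (fun p => f p - g p) i = fun p => dx f i p - dx g i p := by
  funext p
  simp only [dx]
  rw [fderiv_fun_sub (hf.differentiable (by simp) p) (hg.differentiable (by simp) p)]
  simp

lemma dscale_sub {N : ℕ} {f g : ℝ × Eu N → ℝ} (hf : ContDiff ℝ ∞ f) (hg : ContDiff ℝ ∞ g) :
    dscale (fun p => f p - g p) = fun p => dscale f p - dscale g p := by
  funext p
  simp only [dscale]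
  rw [fderiv_fun_sub (hf.differentiable (by simp) p) (hg.differentiable (by simp) p)]
  simp

lemma prod_diff {ι : Type*} [DecidableEq ι] (S : Finset ι) (a b c : ι → ℝ) (om γ : ℝ)
    (hom0 : 0 ≤ om) (hγ : 0 ≤ γ) (hc : ∀ i, 0 ≤ c i) (ha : ∀ i, |a i| ≤ c i * γ)
    (hb : ∀ i, |b i| ≤ c i * γ) (hab : ∀ i, |a i - b i| ≤ c i * om) :
    |∏ i ∈ S, a i| ≤ (∏ i ∈ S, c i) * γ ^ S.card ∧
    |∏ i ∈ S, a i - ∏ i ∈ S, b i| ≤ S.card * (∏ i ∈ S, c i) * (om * γ ^ (S.card - 1)) := by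
  induction S using Finset.induction_on with
  | empty => simp
  | insert i S hi ih =>
    obtain ⟨ih1, ih2⟩ := ih
    simp only [Finset.prod_insert hi, Finset.card_insert_of_notMem hi, Nat.add_sub_cancel]
    have hP : 0 ≤ ∏ i ∈ S, c i := Finset.prod_nonneg fun i _ => hc i
    have hci := hc i
    constructor
    · rw [abs_mul]
      calc _ ≤ (c i * γ) * ((∏ i ∈ S, c i) * γ ^ S.card) := by
            gcongr
            exact ha i
        _ = _ := by ring
    · have e : a i * ∏ j ∈ S, a j - b i * ∏ j ∈ S, b j =
        (a i - b i) * ∏ j ∈ S, a j + b i * (∏ j ∈ S, a j - ∏ j ∈ S, b j) := by ring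
      rw [e]
      refine (abs_add_le _ _).trans ?_
      rw [abs_mul, abs_mul]
      have t1 : |a i - b i| * |∏ j ∈ S, a j| ≤ (c i * om) * ((∏ i ∈ S, c i) * γ ^ S.card) := by
        gcongr
        exact hab i
      have t2 : |b i| * |∏ j ∈ S, a j - ∏ j ∈ S, b j| ≤
          (c i * γ) * (S.card * (∏ i ∈ S, c i) * (om * γ ^ (S.card - 1))) := by
        gcongr
        exact hb i
      have t3 : (c i * γ) * (S.card * (∏ i ∈ S, c i) * (om * γ ^ (S.card - 1))) =
          c i * om * S.card * (∏ i ∈ S, c i) * γ ^ S.card := by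
        rcases Nat.eq_zero_or_pos S.card with h | h
        · simp [h]
        · obtain ⟨m, hm⟩ := Nat.exists_eq_succ_of_ne_zero h.ne'
          rw [hm]
          simp only [Nat.succ_eq_add_one, Nat.add_sub_cancel]
          ring
      rw [t3] at t2
      refine (add_le_add t1 t2).trans (le_of_eq ?_)
      push_cast
      ring

lemma dropProd_mul {N : ℕ} (H : Fin N → Fin N → ℝ) (k : Fin N) (σ : Equiv.Perm (Fin N)) (d : ℝ) :
    dropProd H k σ * d = ∏ j, (if j = k then d else H (σ j) j) := by
  rw [← Finset.prod_erase_mul Finset.univ _ (Finset.mem_univ k), if_pos rfl, dropProd]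
  congr 1
  refine Finset.prod_congr rfl fun j hj => ?_
  rw [if_neg (Finset.ne_of_mem_erase hj)]

lemma Jint_diff {N : ℕ} {u v φ : Eu N → ℝ} (hu : ContDiff ℝ 2 u) (hv : ContDiff ℝ 2 v) {M Φ : ℝ}
    (hM0 : 0 ≤ M) (hM : ∀ z : Eu N, |eta z| ≤ M) (hM' : ∀ i, ∀ z : Eu N, |pd eta i z| ≤ M)
    (hΦ : ∀ i j x, |pd2 φ i j x| ≤ Φ) (s : ℝ) (x : Eu N) :
    |Jint (ext u) φ s x - Jint (ext v) φ s x| ≤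
      (N * (Fintype.card (Equiv.Perm (Fin N))) * N * M ^ N * Φ) *
      ((exp s * exp (-s) ^ (N - 1)) * osc (fun x => u x - v x) s x *
        (osc u s x + osc v s x) ^ (N - 1)) := by
  have hw : ContDiff ℝ 2 (fun x => u x - v x) := hu.sub hv
  set B : ℝ := N * M ^ N * ((exp s * exp (-s) ^ (N - 1)) * osc (fun x => u x - v x) s x *
        (osc u s x + osc v s x) ^ (N - 1)) with hB
  have hB0 : 0 ≤ B := by
    have := osc_nonneg (fun x => u x - v x) s x
    have := osc_nonneg u s x
    have := osc_nonneg v s x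
    positivity
  have key : ∀ k (σ : Equiv.Perm (Fin N)),
      |dropProd (fun i j => dx (dx (ext u) j) i (s, x)) k σ * dscale (ext u) (s, x) -
       dropProd (fun i j => dx (dx (ext v) j) i (s, x)) k σ * dscale (ext v) (s, x)| ≤ B := by
    intro k σ
    have hou := osc_nonneg u s x
    have hov := osc_nonneg v s x
    rw [dropProd_mul, dropProd_mul]
    have := (prod_diff Finset.univ
      (fun j => if j = k then dscale (ext u) (s, x) else dx (dx (ext u) j) (σ j) (s, x))
      (fun j => if j = k then dscale (ext v) (s, x) else dx (dx (ext v) j) (σ j) (s, x))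
      (fun j => if j = k then M * exp s else M * exp (-s))
      (osc (fun x => u x - v x) s x) (osc u s x + osc v s x)
      (osc_nonneg _ _ _) (by positivity) ?_ ?_ ?_ ?_).2
    · refine this.trans (le_of_eq ?_)
      have hp : ∏ j, (if j = k then M * exp s else M * exp (-s)) =
          M ^ N * (exp s * exp (-s) ^ (N - 1)) := by
        rw [← Finset.prod_erase_mul Finset.univ _ (Finset.mem_univ k), if_pos rfl]
        rw [Finset.prod_congr rfl (g := fun _ => M * exp (-s))
          (fun j hj => if_neg (Finset.ne_of_mem_erase hj))]
        rw [Finset.prod_const, Finset.card_erase_of_mem (Finset.mem_univ k), Finset.card_univ,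
          Fintype.card_fin]
        have hN : N = (N - 1) + 1 := by
          have := k.pos
          omega
        conv_rhs => rw [hN]
        simp only [Nat.add_sub_cancel]
        ring
      rw [hp, hB]
      simp only [Finset.card_univ, Fintype.card_fin]
      ring
    · intro j; split_ifs <;> positivity
    · intro j
      split_ifs
      · refine (bound_ds hu hM s x).trans ?_
        gcongr; linarith
      · refine (bound_dxdx hu hM' _ _ s x).trans ?_
        gcongr; linarith
    · intro j
      split_ifs
      · refine (bound_ds hv hM s x).trans ?_
        gcongr; linarith
      · refine (bound_dxdx hv hM' _ _ s x).trans ?_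
        gcongr; linarith
    · intro j
      have eu := ext_contDiff hu.continuous
      have ev := ext_contDiff hv.continuous
      split_ifs
      · have h := bound_ds hw hM s x
        rw [ext_sub hu.continuous hv.continuous, dscale_sub eu ev] at h
        exact h
      · have h := bound_dxdx hw hM' (σ j) j s x
        rw [ext_sub hu.continuous hv.continuous, dx_sub eu ev, dx_sub (contDiff_dx eu _)
          (contDiff_dx ev _)] at h
        exact h
  unfold Jint
  simp_rw [← Finset.sum_sub_distrib]
  have t : ∀ k (σ : Equiv.Perm (Fin N)),
      |((Equiv.Perm.sign σ : ℤ) : ℝ) * (pd2 φ k (σ k) x *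
        dropProd (fun i j => dx (dx (ext u) j) i (s, x)) k σ * dscale (ext u) (s, x)) -
       ((Equiv.Perm.sign σ : ℤ) : ℝ) * (pd2 φ k (σ k) x *
        dropProd (fun i j => dx (dx (ext v) j) i (s, x)) k σ * dscale (ext v) (s, x))| ≤ Φ * B := by
    intro k σ
    rw [← mul_sub, abs_mul]
    have hs : |((Equiv.Perm.sign σ : ℤ) : ℝ)| = 1 := by
      rcases Int.units_eq_one_or (Equiv.Perm.sign σ) with h | h <;> simp [h]
    rw [hs, one_mul, mul_assoc, mul_assoc, ← mul_sub, abs_mul]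
    exact mul_le_mul (hΦ _ _ _) (key k σ) (abs_nonneg _) ((abs_nonneg _).trans (hΦ k k x))
  calc _ ≤ ∑ k : Fin N, ∑ σ : Equiv.Perm (Fin N), Φ * B := by
        refine (Finset.abs_sum_le_sum_abs _ _).trans (Finset.sum_le_sum fun k _ => ?_)
        exact (Finset.abs_sum_le_sum_abs _ _).trans (Finset.sum_le_sum fun σ _ => t k σ)
    _ = _ := by
        simp only [Finset.sum_const, Finset.card_univ, Fintype.card_fin, nsmul_eq_mul, hB]
        ring

end Part4

section Part5
open scoped ContDiff Topology

lemma ext_bound {N : ℕ} {g : Eu N → ℝ} {C : ℝ} (hC : ∀ x, |g x| ≤ C)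
    (p : ℝ × Eu N) : |ext g p| ≤ ∫ z : Eu N, |eta z| * C := by
  unfold ext
  rw [← Real.norm_eq_abs]
  refine norm_integral_le_of_norm_le ?_ (Eventually.of_forall fun z => ?_)
  · exact (((eta_contDiff (N := N)).continuous.integrable_of_hasCompactSupport eta_hcs).abs).mul_const _
  · rw [Real.norm_eq_abs, abs_mul]
    gcongr
    exact hC _

lemma ext_tendsto_bot {N : ℕ} {g : Eu N → ℝ} (hg : Continuous g) {C : ℝ} (hC : ∀ x, |g x| ≤ C)
    (x : Eu N) : Tendsto (fun s => ext g (s, x)) atBot (𝓝 (g x)) := by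
  have hec := (eta_contDiff (N := N)).continuous
  have e : g x = ∫ z : Eu N, eta z * g x := by
    rw [integral_mul_const, eta_int, one_mul]
  rw [e]
  unfold ext
  refine tendsto_integral_filter_of_dominated_convergence (fun z => |eta z| * C) ?_ ?_ ?_ ?_
  · exact Eventually.of_forall fun s => (Continuous.aestronglyMeasurable (by fun_prop))
  · refine Eventually.of_forall fun s => Eventually.of_forall fun z => ?_
    rw [Real.norm_eq_abs, abs_mul]
    gcongr
    exact hC _
  · exact ((hec.integrable_of_hasCompactSupport eta_hcs).abs).mul_const _
  · refine Eventually.of_forall fun z => Tendsto.const_mul _ ?_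
    have h1 : Tendsto (fun s : ℝ => x - exp s • z) atBot (𝓝 (x - (0 : ℝ) • z)) :=
      tendsto_const_nhds.sub (Real.tendsto_exp_atBot.smul_const z)
    have h2 := (hg.tendsto _).comp h1
    simpa [Function.comp_def] using h2

lemma ext_pd_tendsto_top {N : ℕ} {g : Eu N → ℝ} (hg : ContDiff ℝ 1 g) {C : ℝ}
    (hC : ∀ x, |g x| ≤ C) (i : Fin N) (x : Eu N) :
    Tendsto (fun s => ext (pd g i) (s, x)) atTop (𝓝 0) := by
  simp_rw [ext_pd hg]
  have hpe : Continuous (pd (eta (N := N)) i) :=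
    (contDiff_pd eta_contDiff (m := 0) (by simp) i).continuous
  have h0 : Tendsto (fun s : ℝ => exp (-s) * ∫ z : Eu N, |pd eta i z| * C) atTop (𝓝 0) := by
    have := (Real.tendsto_exp_neg_atTop_nhds_zero).mul_const (∫ z : Eu N, |pd eta i z| * C)
    simpa using this
  refine squeeze_zero_norm (fun s => ?_) h0
  rw [norm_mul, Real.norm_eq_abs, Real.abs_exp]
  gcongr
  refine norm_integral_le_of_norm_le ?_ (Eventually.of_forall fun z => ?_)
  · exact ((hpe.integrable_of_hasCompactSupport (hcs_pd eta_hcs i)).abs).mul_const _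
  · rw [Real.norm_eq_abs, abs_mul]
    gcongr
    exact hC _

lemma lim_det {N : ℕ} {u φ : Eu N → ℝ} (hu : ContDiff ℝ 2 u) (huc : HasCompactSupport u)
    (hφ : Continuous φ) (hφc : HasCompactSupport φ) {l : Filter ℝ} [l.IsCountablyGenerated]
    {H : Fin N → Fin N → Eu N → ℝ}
    (hl : ∀ i j x, Tendsto (fun s => ext (pd2 u i j) (s, x)) l (𝓝 (H i j x))) :
    Tendsto (fun s => ∫ x, φ x * hessDet (fun y => ext u (s, y)) x) l
      (𝓝 (∫ x, φ x * ∑ σ : Equiv.Perm (Fin N), ((Equiv.Perm.sign σ : ℤ) : ℝ) *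
        ∏ j, H (σ j) j x)) := by
  have hes := ext_contDiff hu.continuous
  have hpc : ∀ i j, Continuous (pd2 u i j) := fun i j =>
    (contDiff_pd (contDiff_pd hu (m := 1) (by norm_num) j) (m := 0) (by norm_num) i).continuous
  have hb : ∀ i j, ∃ C, ∀ x, |pd2 u i j x| ≤ C := fun i j =>
    (hcs_pd (hcs_pd huc _) _ : HasCompactSupport (pd2 u i j)).exists_bound_of_continuous (hpc i j)
  choose C hC using hb
  set c : Fin N → Fin N → ℝ := fun i j => ∫ z : Eu N, |eta z| * C i j with hc
  have hcb : ∀ i j p, |ext (pd2 u i j) p| ≤ c i j := fun i j p => ext_bound (hC i j) p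
  simp_rw [det_sum, slice_pd2 hes, dx_dx_ext hu]
  refine tendsto_integral_filter_of_dominated_convergence
    (fun x => |φ x| * ∑ σ : Equiv.Perm (Fin N), ∏ j, c (σ j) j) ?_ ?_ ?_ ?_
  · refine Eventually.of_forall fun s => Continuous.aestronglyMeasurable ?_
    refine hφ.mul (continuous_finsetSum _ fun σ _ => continuous_const.mul
      (continuous_finsetProd _ fun j _ => ?_))
    exact (ext_contDiff (hpc _ _)).continuous.comp (by fun_prop : Continuous fun x : Eu N => (s, x))
  · refine Eventually.of_forall fun s => Eventually.of_forall fun x => ?_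
    rw [Real.norm_eq_abs, abs_mul]
    gcongr
    refine (Finset.abs_sum_le_sum_abs _ _).trans (Finset.sum_le_sum fun σ _ => ?_)
    rw [abs_mul, Finset.abs_prod]
    have hs : |((Equiv.Perm.sign σ : ℤ) : ℝ)| = 1 := by
      rcases Int.units_eq_one_or (Equiv.Perm.sign σ) with h | h <;> simp [h]
    rw [hs, one_mul]
    exact Finset.prod_le_prod (fun j _ => abs_nonneg _) fun j _ => hcb _ _ _
  · exact ((hφ.integrable_of_hasCompactSupport hφc).abs).mul_const _
  · refine Eventually.of_forall fun x => Tendsto.const_mul _ ?_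
    refine tendsto_finsetSum _ fun σ _ => Tendsto.const_mul _ ?_
    exact tendsto_finsetProd _ fun j _ => hl _ _ _

lemma lim_bot {N : ℕ} {u φ : Eu N → ℝ} (hu : ContDiff ℝ 2 u) (huc : HasCompactSupport u)
    (hφ : Continuous φ) (hφc : HasCompactSupport φ) :
    Tendsto (fun s => ∫ x, φ x * hessDet (fun y => ext u (s, y)) x) atBot
      (𝓝 (∫ x, φ x * hessDet u x)) := by
  have hpc : ∀ i j, Continuous (pd2 u i j) := fun i j =>
    (contDiff_pd (contDiff_pd hu (m := 1) (by norm_num) j) (m := 0) (by norm_num) i).continuous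
  have := lim_det hu huc hφ hφc (l := atBot) (H := pd2 u) (fun i j x => by
    obtain ⟨C, hC⟩ : ∃ C, ∀ x, |pd2 u i j x| ≤ C :=
      (hcs_pd (hcs_pd huc _) _ : HasCompactSupport (pd2 u i j)).exists_bound_of_continuous (hpc i j)
    exact ext_tendsto_bot (hpc i j) hC x)
  simp_rw [det_sum u]
  exact this

lemma lim_top {N : ℕ} (hN : 0 < N) {u φ : Eu N → ℝ} (hu : ContDiff ℝ 2 u)
    (huc : HasCompactSupport u)
    (hφ : Continuous φ) (hφc : HasCompactSupport φ) :
    Tendsto (fun s => ∫ x, φ x * hessDet (fun y => ext u (s, y)) x) atTop (𝓝 0) := by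
  have := lim_det hu huc hφ hφc (l := atTop) (H := fun _ _ _ => 0) (fun i j x => by
    have hg : ContDiff ℝ 1 (pd u j) := contDiff_pd hu (by norm_num) j
    obtain ⟨C, hC⟩ : ∃ C, ∀ x, |pd u j x| ≤ C :=
      (hcs_pd huc j).exists_bound_of_continuous hg.continuous
    exact ext_pd_tendsto_top hg hC i x)
  simpa [hN.ne'] using this

lemma continuous_Jint {N : ℕ} {f : ℝ × Eu N → ℝ} (hf : ContDiff ℝ ∞ f) {φ : Eu N → ℝ}
    (hφ : ContDiff ℝ 2 φ) : Continuous (fun p : ℝ × Eu N => Jint f φ p.1 p.2) := by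
  have hφ2 : ∀ i j, Continuous (pd2 φ i j) := fun i j =>
    (contDiff_pd (contDiff_pd hφ (m := 1) (by norm_num) j) (m := 0) (by norm_num) i).continuous
  unfold Jint
  refine continuous_finsetSum _ fun k _ => continuous_finsetSum _ fun σ _ => continuous_const.mul ?_
  exact (((hφ2 _ _).comp continuous_snd).mul (continuous_dropProd hf k σ)).mul
    (contDiff_dscale hf).continuous

lemma Jint_integrable {N : ℕ} {f : ℝ × Eu N → ℝ} (hf : ContDiff ℝ ∞ f) {φ : Eu N → ℝ}
    (hφ : ContDiff ℝ 2 φ) (hφc : HasCompactSupport φ) (a b : ℝ) :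
    Integrable (fun p : ℝ × Eu N => Jint f φ p.1 p.2)
      ((volume.restrict (Set.uIoc a b)).prod volume) := by
  have h1 : IntegrableOn (fun p : ℝ × Eu N => Jint f φ p.1 p.2)
        (Set.uIcc a b ×ˢ tsupport φ) :=
      (continuous_Jint hf hφ).continuousOn.integrableOn_compact (isCompact_uIcc.prod hφc)
  have h2 : IntegrableOn (fun p : ℝ × Eu N => Jint f φ p.1 p.2)
      (Set.uIoc a b ×ˢ (Set.univ : Set (Eu N))) := by
    refine h1.of_forall_sdiff_eq_zero (measurableSet_uIoc.prod MeasurableSet.univ) ?_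
    rintro ⟨t, x⟩ ⟨h, h'⟩
    have hx : x ∉ tsupport φ := by
      intro hx
      exact h' ⟨Set.uIoc_subset_uIcc h.1, hx⟩
    have h0 : ∀ i j, pd2 φ i j x = 0 := by
      intro i j
      have t1 : x ∉ tsupport (fun y => fderiv ℝ φ y (ebasis j)) := by
        intro hx'
        refine hx ?_
        have : tsupport (fun y => fderiv ℝ φ y (ebasis j)) ⊆ tsupport (fderiv ℝ φ) := by
          refine closure_mono ?_
          intro y hy hy'
          exact hy (by simp [hy'])
        exact tsupport_fderiv_subset ℝ (this hx')
      simp [pd2, fderiv_of_notMem_tsupport (𝕜 := ℝ) t1]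
    simp [Jint, h0]
  rw [Measure.volume_eq_prod, IntegrableOn, ← Measure.prod_restrict, Measure.restrict_univ] at h2
  exact h2

lemma main_est (N : ℕ) (hN : 0 < N) : ∃ K : ℝ, 0 < K ∧ ∀ u v φ : Eu N → ℝ,
    ContDiff ℝ 2 u → HasCompactSupport u → ContDiff ℝ 2 v → HasCompactSupport v →
    ContDiff ℝ 2 φ → HasCompactSupport φ → ∀ Φ : ℝ, (∀ i j x, |pd2 φ i j x| ≤ Φ) →
    ENNReal.ofReal |(∫ x, φ x * hessDet u x) - ∫ x, φ x * hessDet v x| ≤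
      ENNReal.ofReal (K * Φ) * ∫⁻ p : ℝ × Eu N, ENNReal.ofReal
        ((exp p.1 * exp (-p.1) ^ (N - 1)) * osc (fun x => u x - v x) p.1 p.2 *
        (osc u p.1 p.2 + osc v p.1 p.2) ^ (N - 1)) := by
  obtain ⟨M, hM0, hM, hM'⟩ := eta_bound N
  refine ⟨N * (Fintype.card (Equiv.Perm (Fin N))) * N * M ^ N, ?_, ?_⟩
  · have : 0 < Fintype.card (Equiv.Perm (Fin N)) := Fintype.card_pos
    positivity
  intro u v φ hu huc hv hvc hφ hφc Φ hΦ
  have eu := ext_contDiff hu.continuous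
  have ev := ext_contDiff hv.continuous
  have hΦ0 : 0 ≤ Φ := (abs_nonneg _).trans (hΦ ⟨0, hN⟩ ⟨0, hN⟩ 0)
  set K : ℝ := N * (Fintype.card (Equiv.Perm (Fin N))) * N * M ^ N with hK
  set R := ENNReal.ofReal (K * Φ) * ∫⁻ p : ℝ × Eu N, ENNReal.ofReal
        ((exp p.1 * exp (-p.1) ^ (N - 1)) * osc (fun x => u x - v x) p.1 p.2 *
        (osc u p.1 p.2 + osc v p.1 p.2) ^ (N - 1)) with hR
  set X : (Eu N → ℝ) → ℝ → ℝ := fun u s => ∫ x, φ x * hessDet (fun y => ext u (s, y)) x with hX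
  have main : ∀ n : ℝ, 0 ≤ n →
      ENNReal.ofReal |(X u n - X u (-n)) - (X v n - X v (-n))| ≤ R := by
    intro n hn
    have hab : -n ≤ n := by linarith
    have conv : ∀ f : ℝ × Eu N → ℝ, ContDiff ℝ ∞ f → ∫ s in (-n)..n, ∫ x, Jint f φ s x =
        ∫ p, Jint f φ p.1 p.2 ∂((volume.restrict (Set.uIoc (-n) n)).prod volume) := by
      intro f hf
      rw [integral_prod _ (Jint_integrable hf hφ hφc _ _), intervalIntegral.integral_of_le hab,
        Set.uIoc_of_le hab]
    simp only [hX]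
    rw [time_identity eu hφ hφc, time_identity ev hφ hφc, conv _ eu, conv _ ev,
      ← integral_sub (Jint_integrable eu hφ hφc _ _) (Jint_integrable ev hφ hφc _ _)]
    rw [← Real.enorm_eq_ofReal_abs]
    refine (enorm_integral_le_lintegral_enorm _).trans ?_
    rw [hR, ← lintegral_const_mul' _ _ ENNReal.ofReal_ne_top]
    have hmono : ((volume.restrict (Set.uIoc (-n) n)).prod volume : Measure (ℝ × Eu N)) ≤ volume := by
      rw [Measure.volume_eq_prod]
      exact Measure.prod_mono Measure.restrict_le_self le_rfl
    refine (lintegral_mono' hmono (le_refl _)).trans (lintegral_mono fun p => ?_)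
    rw [← ENNReal.ofReal_mul (by positivity), Real.enorm_eq_ofReal_abs]
    refine ENNReal.ofReal_le_ofReal ?_
    exact Jint_diff hu hv hM0.le hM hM' hΦ p.1 p.2
  have hlim : Tendsto (fun n : ℝ => ENNReal.ofReal |(X u n - X u (-n)) - (X v n - X v (-n))|) atTop
      (𝓝 (ENNReal.ofReal |(0 - ∫ x, φ x * hessDet u x) - (0 - ∫ x, φ x * hessDet v x)|)) := by
    refine (ENNReal.continuous_ofReal.tendsto _).comp (Tendsto.abs ?_)
    refine ((lim_top hN hu huc hφ.continuous hφc).sub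
      ((lim_bot hu huc hφ.continuous hφc).comp tendsto_neg_atTop_atBot)).sub
      ((lim_top hN hv hvc hφ.continuous hφc).sub
      ((lim_bot hv hvc hφ.continuous hφc).comp tendsto_neg_atTop_atBot))
  have fin := le_of_tendsto hlim ((eventually_ge_atTop 0).mono main)
  have e : |(0 - ∫ x, φ x * hessDet u x) - (0 - ∫ x, φ x * hessDet v x)| =
      |(∫ x, φ x * hessDet u x) - ∫ x, φ x * hessDet v x| := by
    rw [abs_sub_comm]
    congr 1
    ring
  rwa [e] at fin

end Part5

section Part6
open scoped ContDiff Topology ENNReal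

/-- Extended nonnegative version of the oscillation. -/
def oscE {N : ℕ} (G : Eu N → (Eu N →L[ℝ] ℝ)) (p : ℝ × Eu N) : ℝ≥0∞ :=
  ∫⁻ z in Metric.closedBall (0 : Eu N) 1, ‖G (p.2 - exp p.1 • z) - G p.2‖ₑ

/-- The weight in the time variable. -/
def wtE (N : ℕ) (p : ℝ × Eu N) : ℝ≥0∞ := ENNReal.ofReal (exp p.1 * exp (-p.1) ^ (N - 1))

lemma wtE_meas (N : ℕ) : Measurable (wtE N) := by
  unfold wtE
  fun_prop

lemma oscE_meas {N : ℕ} {G : Eu N → (Eu N →L[ℝ] ℝ)} (hG : Continuous G) :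
    Measurable (oscE G) := by
  unfold oscE
  have : Measurable (fun q : (ℝ × Eu N) × Eu N =>
      ‖G (q.1.2 - exp q.1.1 • q.2) - G q.1.2‖ₑ) := by
    apply Continuous.measurable
    fun_prop
  exact this.lintegral_prod_right'

lemma ofReal_osc {N : ℕ} {u : Eu N → ℝ} (hG : Continuous (fderiv ℝ u)) (p : ℝ × Eu N) :
    ENNReal.ofReal (osc u p.1 p.2) = oscE (fderiv ℝ u) p := by
  unfold osc oscE
  rw [ofReal_integral_eq_lintegral_ofReal]
  · simp only [ofReal_norm]
  · apply ContinuousOn.integrableOn_compact (isCompact_closedBall _ _)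
    fun_prop
  · exact Eventually.of_forall fun _ => norm_nonneg _

lemma holder_conj {N : ℕ} (hN : 3 ≤ N) : (N : ℝ).HolderConjugate ((N : ℝ) / (N - 1)) := by
  have h : (3 : ℝ) ≤ N := by exact_mod_cast hN
  rw [Real.holderConjugate_iff]
  refine ⟨by linarith, ?_⟩
  have : (N : ℝ) - 1 ≠ 0 := by linarith
  field_simp
  ring

lemma holder_step {N : ℕ} (hN : 3 ≤ N) {A B C : ℝ × Eu N → ℝ≥0∞} (hA : Measurable A)
    (hB : Measurable B) (hC : Measurable C) :
    ∫⁻ p, wtE N p * A p * (B p + C p) ^ (N - 1) ≤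
      (∫⁻ p, wtE N p * A p ^ N) ^ (1 / (N : ℝ)) *
      ((∫⁻ p, wtE N p * B p ^ N) ^ (1 / (N : ℝ)) + (∫⁻ p, wtE N p * C p ^ N) ^ (1 / (N : ℝ))) ^ (N - 1) := by
  have h : (3 : ℝ) ≤ N := by exact_mod_cast hN
  have hc := holder_conj hN
  set μ := (volume : Measure (ℝ × Eu N)).withDensity (wtE N) with hμ
  have e1 : ∀ F : ℝ × Eu N → ℝ≥0∞, Measurable F → ∫⁻ p, wtE N p * F p = ∫⁻ p, F p ∂μ := by
    intro F hF
    rw [hμ, lintegral_withDensity_eq_lintegral_mul _ (wtE_meas N) hF]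
    rfl
  simp only [mul_assoc]
  rw [e1 _ (by fun_prop), e1 _ (by fun_prop), e1 _ (by fun_prop), e1 _ (by fun_prop)]
  have H := ENNReal.lintegral_mul_rpow_le_lintegral_rpow_mul_lintegral_rpow (μ := μ) hc
    hA.aemeasurable (hB.add hC).aemeasurable
  have M := ENNReal.lintegral_Lp_add_le (μ := μ) hB.aemeasurable hC.aemeasurable
    (p := N) (by linarith)
  have e2 : (N : ℝ) - 1 = ((N - 1 : ℕ) : ℝ) := by
    rw [Nat.cast_sub (by omega)]; simp
  simp only [ENNReal.rpow_natCast] at H M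
  have e3 : 1 / ((N : ℝ) / ((N : ℝ) - 1)) = (1 / (N : ℝ)) * ((N - 1 : ℕ) : ℝ) := by
    rw [← e2]; field_simp
  rw [e3, ENNReal.rpow_mul, e2] at H
  simp only [ENNReal.rpow_natCast] at H
  refine H.trans ?_
  gcongr

lemma jensen_step {N : ℕ} (hN : 3 ≤ N) : ∃ c : ℝ≥0∞, c ≠ ⊤ ∧
    ∀ F : Eu N → ℝ≥0∞, Measurable F → (∫⁻ z in Metric.closedBall (0 : Eu N) 1, F z) ^ N ≤
      c * ∫⁻ z in Metric.closedBall (0 : Eu N) 1, F z ^ N := by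
  have h : (3 : ℝ) ≤ N := by exact_mod_cast hN
  have hc := holder_conj hN
  refine ⟨((volume (Metric.closedBall (0 : Eu N) 1)) ^ (1 / ((N : ℝ) / (N - 1)))) ^ N, ?_, ?_⟩
  · apply ENNReal.pow_ne_top
    apply ENNReal.rpow_ne_top_of_nonneg
    · have := hc.symm.pos
      positivity
    · exact (isCompact_closedBall _ _).measure_lt_top.ne
  intro F hF
  have H := ENNReal.lintegral_mul_le_Lp_mul_Lq (volume.restrict (Metric.closedBall (0 : Eu N) 1)) hc
    hF.aemeasurable (g := fun _ => 1) aemeasurable_const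
  simp only [Pi.mul_apply, mul_one, ENNReal.one_rpow, lintegral_const, one_mul,
    Measure.restrict_apply MeasurableSet.univ, Set.univ_inter, ENNReal.rpow_natCast] at H
  refine (pow_le_pow_left' H N).trans ?_
  rw [mul_pow, mul_comm, ← ENNReal.rpow_natCast (_ ^ (1 / (N : ℝ))), ← ENNReal.rpow_mul]
  rw [one_div_mul_cancel (by linarith), ENNReal.rpow_one]

lemma cov_step {N : ℕ} (s : ℝ) (x : Eu N) {F : Eu N → ℝ≥0∞} (hF : Measurable F) :
    ∫⁻ z in Metric.closedBall (0 : Eu N) 1, F (x - exp s • z) =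
      ENNReal.ofReal (exp (-s) ^ N) * ∫⁻ y in Metric.closedBall x (exp s), F y := by
  have hb : ∀ z : Eu N, (z ∈ Metric.closedBall (0 : Eu N) 1) ↔
      (x - exp s • z) ∈ Metric.closedBall x (exp s) := by
    intro z
    simp only [Metric.mem_closedBall, dist_zero_right, dist_self_sub_left, norm_smul,
      Real.norm_eq_abs, abs_exp]
    constructor
    · intro h; nlinarith [exp_pos s]
    · intro h; by_contra h'; push Not at h'; nlinarith [exp_pos s]
  rw [← lintegral_indicator Metric.isClosed_closedBall.measurableSet,
    ← lintegral_indicator Metric.isClosed_closedBall.measurableSet]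
  set K : Eu N → ℝ≥0∞ := Set.indicator (Metric.closedBall x (exp s)) F with hK
  have hKm : Measurable K := hF.indicator Metric.isClosed_closedBall.measurableSet
  have e1 : ∀ z, Set.indicator (Metric.closedBall (0 : Eu N) 1) (fun z => F (x - exp s • z)) z =
      (fun w => K (x - w)) (exp s • z) := by
    intro z
    by_cases hz : z ∈ Metric.closedBall (0 : Eu N) 1
    · simp only [hK, Set.indicator_of_mem hz, Set.indicator_of_mem ((hb z).1 hz)]
    · simp only [hK, Set.indicator_of_notMem hz,
        Set.indicator_of_notMem (fun h => hz ((hb z).2 h))]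
  simp_rw [e1]
  have m1 : Measurable (fun w => K (x - w)) := by fun_prop
  rw [← lintegral_map (μ := volume) (g := fun z : Eu N => exp s • z) m1 (by fun_prop),
    Measure.map_addHaar_smul _ (exp_pos s).ne', lintegral_smul_measure,
    lintegral_sub_left_eq_self K x]
  simp only [finrank_euclideanSpace, Fintype.card_fin, smul_eq_mul]
  congr 2
  rw [abs_of_pos (by positivity), exp_neg, inv_pow]

lemma time_step {N : ℕ} (hN : 3 ≤ N) {r : ℝ} (hr : 0 < r) :
    ∫⁻ s : ℝ, (Set.indicator {s : ℝ | r ≤ exp s}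
      (fun s => ENNReal.ofReal (exp s * exp (-s) ^ (N - 1) * exp (-s) ^ N)) s) ≤
      ENNReal.ofReal (1 / r ^ (2 * N - 2)) := by
  have h : (3 : ℝ) ≤ N := by exact_mod_cast hN
  have e1 : {s : ℝ | r ≤ exp s} = Set.Ici (log r) := by
    ext s
    simp [Real.log_le_iff_le_exp hr]
  rw [e1, lintegral_indicator measurableSet_Ici, setLIntegral_congr Ioi_ae_eq_Ici.symm]
  have ha : (2 - 2 * (N : ℝ)) < 0 := by linarith
  have e2 : ∀ s : ℝ, exp s * exp (-s) ^ (N - 1) * exp (-s) ^ N = exp ((2 - 2 * (N : ℝ)) * s) := by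
    intro s
    rw [← exp_nat_mul, ← exp_nat_mul, ← exp_add, ← exp_add, Nat.cast_sub (by omega)]
    congr 1
    push_cast
    ring
  simp_rw [e2]
  rw [← ofReal_integral_eq_lintegral_ofReal (integrableOn_exp_mul_Ioi ha _)
    (Eventually.of_forall fun _ => (exp_pos _).le), integral_exp_mul_Ioi ha]
  refine ENNReal.ofReal_le_ofReal ?_
  have e3 : exp ((2 - 2 * (N : ℝ)) * log r) = 1 / r ^ (2 * N - 2) := by
    rw [mul_comm, exp_mul, exp_log hr, one_div, ← rpow_natCast, ← rpow_neg hr.le,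
      Nat.cast_sub (by omega)]
    congr 1
    push_cast
    ring
  rw [e3]
  have : 0 ≤ 1 / r ^ (2 * N - 2) := by positivity
  rw [neg_div, ← div_neg]
  exact div_le_self this (by linarith)

/-- The double integral of the Besov norm, as a lower integral. -/
def QE {N : ℕ} (G : Eu N → (Eu N →L[ℝ] ℝ)) : ℝ≥0∞ :=
  ∫⁻ x : Eu N, ∫⁻ y : Eu N, ENNReal.ofReal (‖G x - G y‖ ^ N / ‖x - y‖ ^ (2 * N - 2))

lemma swap3 {N : ℕ} {T : ℝ → Eu N → Eu N → ℝ≥0∞}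
    (hTm : Measurable (fun q : ℝ × (Eu N × Eu N) => T q.1 q.2.1 q.2.2)) :
    ∫⁻ s : ℝ, ∫⁻ x : Eu N, ∫⁻ y, T s x y = ∫⁻ x : Eu N, ∫⁻ y, ∫⁻ s : ℝ, T s x y := by
  rw [lintegral_lintegral_swap]
  · refine lintegral_congr fun x => ?_
    rw [lintegral_lintegral_swap]
    have : Measurable (fun q : ℝ × Eu N => T q.1 x q.2) :=
      hTm.comp (measurable_fst.prodMk (measurable_const.prodMk measurable_snd))
    exact this.aemeasurable
  · have : Measurable (fun q : (ℝ × Eu N) × Eu N => T q.1.1 q.1.2 q.2) :=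
      hTm.comp (measurable_fst.fst.prodMk (measurable_fst.snd.prodMk measurable_snd))
    exact this.lintegral_prod_right'.aemeasurable

lemma energy_step {N : ℕ} (hN : 3 ≤ N) : ∃ c : ℝ≥0∞, c ≠ ⊤ ∧
    ∀ G : Eu N → (Eu N →L[ℝ] ℝ), Continuous G →
      ∫⁻ p, wtE N p * oscE G p ^ N ≤ c * QE G := by
  obtain ⟨c, hc, hJ⟩ := jensen_step hN
  refine ⟨c, hc, ?_⟩
  intro G hG
  have hm : Measurable (fun p => wtE N p * oscE G p ^ N) :=
    (wtE_meas N).mul ((oscE_meas hG).pow_const N)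
  rw [Measure.volume_eq_prod, lintegral_prod _ hm.aemeasurable]
  set T : ℝ → Eu N → Eu N → ℝ≥0∞ := fun s x y =>
    Set.indicator {s : ℝ | ‖x - y‖ ≤ exp s}
      (fun s => ENNReal.ofReal (exp s * exp (-s) ^ (N - 1) * exp (-s) ^ N)) s * ‖G x - G y‖ₑ ^ N
    with hT
  have hTm : Measurable (fun q : ℝ × (Eu N × Eu N) => T q.1 q.2.1 q.2.2) := by
    simp only [hT]
    apply Measurable.mul
    · have hs : MeasurableSet {q : ℝ × (Eu N × Eu N) | ‖q.2.1 - q.2.2‖ ≤ exp q.1} := by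
        apply IsClosed.measurableSet
        apply isClosed_le <;> fun_prop
      have : Measurable (fun q : ℝ × (Eu N × Eu N) =>
        ENNReal.ofReal (exp q.1 * exp (-q.1) ^ (N - 1) * exp (-q.1) ^ N)) := by fun_prop
      exact this.indicator hs
    · apply Measurable.pow_const
      apply Continuous.measurable
      fun_prop
  have step1 : ∀ s x, wtE N (s, x) * oscE G (s, x) ^ N ≤ c * ∫⁻ y, T s x y := by
    intro s x
    have hF : Measurable (fun y => ‖G y - G x‖ₑ) := by
      apply Continuous.measurable
      fun_prop
    have j := hJ (fun z => ‖G (x - exp s • z) - G x‖ₑ) (by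
      apply Continuous.measurable
      fun_prop)
    have cv := cov_step s x (hF.pow_const N)
    rw [cv] at j
    calc wtE N (s, x) * oscE G (s, x) ^ N
        ≤ wtE N (s, x) * (c * (ENNReal.ofReal (exp (-s) ^ N) *
          ∫⁻ y in Metric.closedBall x (exp s), ‖G y - G x‖ₑ ^ N)) := by
          gcongr
          exact j
      _ = c * ∫⁻ y, T s x y := by
          rw [mul_left_comm, ← mul_assoc (wtE N (s, x))]
          congr 1
          rw [wtE, ← ENNReal.ofReal_mul (by positivity),
            ← lintegral_const_mul' _ _ ENNReal.ofReal_ne_top,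
            ← lintegral_indicator Metric.isClosed_closedBall.measurableSet]
          refine lintegral_congr fun y => ?_
          simp only [hT, Set.indicator, Metric.mem_closedBall, dist_eq_norm, Set.mem_ofPred_eq]
          rw [norm_sub_rev y x, ← enorm_neg, neg_sub]
          split_ifs <;> simp
  calc ∫⁻ s : ℝ, ∫⁻ x : Eu N, wtE N (s, x) * oscE G (s, x) ^ N
      ≤ ∫⁻ s : ℝ, ∫⁻ x : Eu N, c * ∫⁻ y, T s x y :=
        lintegral_mono fun s => lintegral_mono fun x => step1 s x
    _ = c * ∫⁻ s : ℝ, ∫⁻ x : Eu N, ∫⁻ y, T s x y := by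
        simp_rw [lintegral_const_mul' _ _ hc]
    _ = c * ∫⁻ x : Eu N, ∫⁻ y, ∫⁻ s : ℝ, T s x y := by rw [swap3 hTm]
    _ ≤ c * QE G := by
        unfold QE
        gcongr with x y
        simp only [hT]
        rw [lintegral_mul_const' _ _ (by finiteness)]
        rcases eq_or_ne x y with rfl | hxy
        · have : N ≠ 0 := by omega
          have h0 : ‖G x - G x‖ₑ ^ N = 0 := by
            rw [← ofReal_norm, sub_self, norm_zero, ENNReal.ofReal_zero, zero_pow this]
          rw [h0, mul_zero]
          exact zero_le
        · have hr : 0 < ‖x - y‖ := norm_pos_iff.2 (sub_ne_zero.2 hxy)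
          refine (mul_le_mul_left (time_step hN hr) _).trans (le_of_eq ?_)
          rw [← ofReal_norm, ← ENNReal.ofReal_pow (norm_nonneg _),
            ← ENNReal.ofReal_mul (by positivity)]
          congr 1
          ring

end Part6

section Part7
open scoped ContDiff Topology ENNReal

lemma kernel_integrable {N : ℕ} (hN : 3 ≤ N) {L M : ℝ} (hL : 0 ≤ L) (hM : 0 ≤ M) :
    Integrable (fun h : Eu N => (min (L * ‖h‖) M) ^ N / ‖h‖ ^ (2 * N - 2)) := by
  have h3 : (3 : ℝ) ≤ N := by exact_mod_cast hN
  have : Nontrivial (Eu N) := by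
    have : Nonempty (Fin N) := ⟨⟨0, by omega⟩⟩
    infer_instance
  have hp := integrable_fun_norm_addHaar (volume : Measure (Eu N))
    (f := fun r : ℝ => (min (L * r) M) ^ N / r ^ (2 * N - 2))
  rw [hp]
  simp only [finrank_euclideanSpace, Fintype.card_fin, smul_eq_mul]
  have hmeas : Measurable (fun y : ℝ => y ^ (N - 1) * ((min (L * y) M) ^ N / y ^ (2 * N - 2))) := by
    fun_prop
  rw [← Set.Ioc_union_Ioi_eq_Ioi (zero_le_one (α := ℝ))]
  apply IntegrableOn.union
  · have : IntegrableOn (fun _ : ℝ => L ^ N) (Set.Ioc (0 : ℝ) 1) := by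
      exact integrableOn_const (by simp)
    refine Integrable.mono' this hmeas.aestronglyMeasurable ?_
    filter_upwards [ae_restrict_mem measurableSet_Ioc] with y hy
    have hy0 : 0 < y := hy.1
    have hmin : 0 ≤ min (L * y) M := le_min (by positivity) hM
    rw [Real.norm_of_nonneg (by positivity)]
    calc y ^ (N - 1) * ((min (L * y) M) ^ N / y ^ (2 * N - 2))
        ≤ y ^ (N - 1) * ((L * y) ^ N / y ^ (2 * N - 2)) := by
          gcongr
          exact min_le_left _ _
      _ = L ^ N * y := by
          obtain ⟨k, rfl⟩ : ∃ k, N = k + 1 := ⟨N - 1, by omega⟩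
          have : 2 * (k + 1) - 2 = k + k := by omega
          rw [this, Nat.add_sub_cancel]
          field_simp
          ring
      _ ≤ L ^ N := mul_le_of_le_one_right (by positivity) hy.2
  · have : IntegrableOn (fun y : ℝ => M ^ N * y ^ (1 - (N : ℝ))) (Set.Ioi (1 : ℝ)) :=
      (integrableOn_Ioi_rpow_of_lt (by linarith) one_pos).const_mul _
    refine Integrable.mono' this hmeas.aestronglyMeasurable ?_
    filter_upwards [ae_restrict_mem measurableSet_Ioi] with y hy
    have hy0 : 0 < y := one_pos.trans hy
    have hmin : 0 ≤ min (L * y) M := le_min (by positivity) hM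
    rw [Real.norm_of_nonneg (by positivity)]
    calc y ^ (N - 1) * ((min (L * y) M) ^ N / y ^ (2 * N - 2))
        ≤ y ^ (N - 1) * (M ^ N / y ^ (2 * N - 2)) := by
          gcongr
          exact min_le_right _ _
      _ = M ^ N * y ^ (1 - (N : ℝ)) := by
          obtain ⟨k, rfl⟩ : ∃ k, N = k + 1 := ⟨N - 1, by omega⟩
          have h2 : 2 * (k + 1) - 2 = k + k := by omega
          have h3 : (1 - ((k + 1 : ℕ) : ℝ)) = -(k : ℝ) := by push_cast; ring
          rw [h2, Nat.add_sub_cancel, h3, rpow_neg hy0.le, rpow_natCast]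
          field_simp
          ring

lemma diff_integrable {N : ℕ} (hN : 3 ≤ N) {G : Eu N → (Eu N →L[ℝ] ℝ)} {L : NNReal}
    (hL : LipschitzWith L G) (hc : HasCompactSupport G) :
    Integrable (fun q : Eu N × Eu N => ‖G q.1 - G q.2‖ ^ N / ‖q.1 - q.2‖ ^ (2 * N - 2))
      (volume.prod volume) := by
  have hG := hL.continuous
  obtain ⟨M, hM⟩ := hc.exists_bound_of_continuous hG
  have hM0 : 0 ≤ M := (norm_nonneg _).trans (hM 0)
  set k : Eu N → ℝ := fun h => (min (L * ‖h‖) (2 * M)) ^ N / ‖h‖ ^ (2 * N - 2) with hk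
  have hki : Integrable k := kernel_integrable hN L.coe_nonneg (by positivity)
  set χ : Eu N → ℝ := Set.indicator (tsupport G) (fun _ => 1) with hχ
  have hχi : Integrable χ := by
    rw [hχ, integrable_indicator_iff (isClosed_tsupport G).measurableSet]
    exact integrableOn_const (hc.isCompact.measure_lt_top.ne)
  have i1 : Integrable (fun q : Eu N × Eu N => χ q.1 * k (q.2 - q.1)) (volume.prod volume) := by
    have := hχi.mul_prod hki
    have mp := measurePreserving_prod_sub (volume : Measure (Eu N)) (volume : Measure (Eu N))
    exact mp.integrable_comp_of_integrable this
  have i2 : Integrable (fun q : Eu N × Eu N => χ q.2 * k (q.1 - q.2)) (volume.prod volume) := 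
    i1.swap
  refine Integrable.mono' (i1.add i2) ?_ ?_
  · apply Measurable.aestronglyMeasurable
    apply Measurable.div <;> apply Continuous.measurable <;> fun_prop
  · refine Eventually.of_forall fun q => ?_
    obtain ⟨x, y⟩ := q
    have hk0 : ∀ h, 0 ≤ k h := fun h => by
      have : 0 ≤ min (L * ‖h‖) (2 * M) := le_min (by positivity) (by positivity)
      simp only [hk]
      positivity
    have hχ0 : ∀ h, 0 ≤ χ h := fun h => Set.indicator_nonneg (fun _ _ => zero_le_one) _
    have hsym : k (y - x) = k (x - y) := by simp only [hk, norm_sub_rev]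
    rw [Real.norm_of_nonneg (by positivity)]
    simp only [Pi.add_apply]
    rw [hsym, ← add_mul]
    have hle : ‖G x - G y‖ ^ N / ‖x - y‖ ^ (2 * N - 2) ≤ k (x - y) := by
      simp only [hk]
      gcongr
      refine le_min (hL.norm_sub_le x y) ?_
      refine (norm_sub_le _ _).trans ?_
      linarith [hM x, hM y]
    by_cases hx : x ∈ tsupport G
    · have : χ x = 1 := Set.indicator_of_mem hx _
      refine hle.trans ?_
      rw [this]
      nlinarith [hk0 (x - y), hχ0 y]
    by_cases hy : y ∈ tsupport G
    · have : χ y = 1 := Set.indicator_of_mem hy _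
      refine hle.trans ?_
      rw [this]
      nlinarith [hk0 (x - y), hχ0 x]
    · have hN0 : N ≠ 0 := by omega
      rw [image_eq_zero_of_notMem_tsupport hx, image_eq_zero_of_notMem_tsupport hy, sub_zero,
        norm_zero, zero_pow hN0, zero_div]
      exact mul_nonneg (add_nonneg (hχ0 _) (hχ0 _)) (hk0 _)

lemma QE_le {N : ℕ} (hN : 3 ≤ N) {u : Eu N → ℝ} (hu : ContDiff ℝ 2 u) (hc : HasCompactSupport u) :
    (QE (fderiv ℝ u)) ^ (1 / (N : ℝ)) ≤ ENNReal.ofReal (besov N (2 - 2 / (N : ℝ)) N u) := by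
  have h3 : (3 : ℝ) ≤ N := by exact_mod_cast hN
  have hG : ContDiff ℝ 1 (fderiv ℝ u) := hu.fderiv_right (by norm_num)
  have hGc : HasCompactSupport (fderiv ℝ u) := hc.fderiv ℝ
  obtain ⟨L, hL⟩ := hG.lipschitzWith_of_hasCompactSupport hGc one_ne_zero
  have hi := diff_integrable hN hL hGc
  set D : ℝ := ∫ x : Eu N, ∫ y : Eu N,
    ‖fderiv ℝ u x - fderiv ℝ u y‖ ^ N / ‖x - y‖ ^ (2 * N - 2) with hD
  have hD0 : 0 ≤ D := integral_nonneg fun x => integral_nonneg fun y => by positivity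
  have e1 : QE (fderiv ℝ u) = ENNReal.ofReal D := by
    have := integral_prod _ hi
    simp only at this
    rw [hD, ← this, ofReal_integral_eq_lintegral_ofReal hi
      (Eventually.of_forall fun q => by positivity), lintegral_prod]
    · rfl
    · exact hi.aestronglyMeasurable.aemeasurable.ennreal_ofReal
  rw [e1, ENNReal.ofReal_rpow_of_nonneg hD0 (by positivity)]
  refine ENNReal.ofReal_le_ofReal ?_
  have e2 : (N : ℝ) + (2 - 2 / (N : ℝ) - 1) * N = ((2 * N - 2 : ℕ) : ℝ) := by
    rw [Nat.cast_sub (by omega)]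
    push_cast
    field_simp
    ring
  unfold besov
  rw [e2]
  simp only [rpow_natCast]
  rw [← hD]
  have a1 : 0 ≤ (∫ x : Eu N, |u x| ^ N) ^ (1 / (N : ℝ)) :=
    rpow_nonneg (integral_nonneg fun x => by positivity) _
  have a2 : 0 ≤ (∫ x : Eu N, ‖fderiv ℝ u x‖ ^ N) ^ (1 / (N : ℝ)) :=
    rpow_nonneg (integral_nonneg fun x => by positivity) _
  linarith

lemma besov_nonneg (N : ℕ) (s p : ℝ) (u : Eu N → ℝ) : 0 ≤ besov N s p u := by
  unfold besov
  refine add_nonneg (add_nonneg ?_ ?_) ?_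
  · exact rpow_nonneg (integral_nonneg fun x => by positivity) _
  · exact rpow_nonneg (integral_nonneg fun x => by positivity) _
  · exact rpow_nonneg (integral_nonneg fun x => integral_nonneg fun y => by positivity) _

lemma pd2_le_iter {N : ℕ} {φ : Eu N → ℝ} (hφ : ContDiff ℝ 2 φ) (i j : Fin N) (x : Eu N) :
    |pd2 φ i j x| ≤ ‖iteratedFDeriv ℝ 2 φ x‖ := by
  have hG : ContDiff ℝ 1 (fderiv ℝ φ) := hφ.fderiv_right (by norm_num)
  have e : pd2 φ i j x = iteratedFDeriv ℝ 2 φ x ![ebasis i, ebasis j] := by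
    rw [iteratedFDeriv_two_apply]
    unfold pd2
    rw [fderiv_clm_apply (hG.differentiable one_ne_zero x) (differentiableAt_const _)]
    simp
  rw [e, ← Real.norm_eq_abs]
  refine (ContinuousMultilinearMap.le_opNorm _ _).trans ?_
  simp [Fin.prod_univ_two, norm_ebasis]

lemma iter_bdd {N : ℕ} {φ : Eu N → ℝ} (hφ : ContDiff ℝ 2 φ) (hc : HasCompactSupport φ) :
    BddAbove (Set.range fun x => ‖iteratedFDeriv ℝ 2 φ x‖) := by
  have h1 : Continuous (iteratedFDeriv ℝ 2 φ) := hφ.continuous_iteratedFDeriv (by norm_num)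
  obtain ⟨M, hM⟩ := (hc.iteratedFDeriv (𝕜 := ℝ) 2).exists_bound_of_continuous h1
  exact ⟨M, by rintro _ ⟨x, rfl⟩; exact hM x⟩

lemma hessDet_cont {N : ℕ} {u : Eu N → ℝ} (hu : ContDiff ℝ 2 u) : Continuous (hessDet u) := by
  unfold hessDet
  apply Continuous.matrix_det
  refine continuous_matrix fun i j => ?_
  have hG : ContDiff ℝ 1 (fun y => fderiv ℝ u y (ebasis j)) :=
    (hu.fderiv_right (m := 1) (by norm_num)).clm_apply contDiff_const
  exact (hG.continuous_fderiv one_ne_zero).clm_apply continuous_const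

end Part7

section Part8
open scoped ContDiff Topology ENNReal

lemma real_est {N : ℕ} (hN : 3 ≤ N) : ∃ K : ℝ, 0 ≤ K ∧ ∀ u v φ : Eu N → ℝ,
    ContDiff ℝ 2 u → HasCompactSupport u → ContDiff ℝ 2 v → HasCompactSupport v →
    ContDiff ℝ 2 φ → HasCompactSupport φ → ∀ Φ : ℝ, 0 ≤ Φ → (∀ i j x, |pd2 φ i j x| ≤ Φ) →
    |(∫ x, φ x * hessDet u x) - ∫ x, φ x * hessDet v x| ≤
      K * besov N (2 - 2 / (N : ℝ)) N (fun x => u x - v x) *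
        (besov N (2 - 2 / (N : ℝ)) N u + besov N (2 - 2 / (N : ℝ)) N v) ^ (N - 1) * Φ := by
  obtain ⟨K, hK, hmain⟩ := main_est N (by omega)
  obtain ⟨c, hc, hE⟩ := energy_step hN
  have hc' : c ^ (1 / (N : ℝ)) ≠ ⊤ := ENNReal.rpow_ne_top_of_nonneg (by positivity) hc
  set d : ℝ := (c ^ (1 / (N : ℝ))).toReal with hd
  have hd0 : 0 ≤ d := ENNReal.toReal_nonneg
  have hcd : c ^ (1 / (N : ℝ)) = ENNReal.ofReal d := (ENNReal.ofReal_toReal hc').symm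
  refine ⟨K * d * d ^ (N - 1), by positivity, ?_⟩
  intro u v φ hu huc hv hvc hφ hφc Φ hΦ0 hΦ
  have hw : ContDiff ℝ 2 (fun x => u x - v x) := hu.sub hv
  have hwc : HasCompactSupport (fun x => u x - v x) := huc.sub hvc
  have key : ∀ f : Eu N → ℝ, ContDiff ℝ 2 f → HasCompactSupport f →
      (∫⁻ p, wtE N p * oscE (fderiv ℝ f) p ^ N) ^ (1 / (N : ℝ)) ≤
        ENNReal.ofReal (d * besov N (2 - 2 / (N : ℝ)) N f) := by
    intro f hf hfc
    refine (ENNReal.rpow_le_rpow (hE _ (hf.continuous_fderiv two_ne_zero)) (by positivity)).trans ?_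
    rw [ENNReal.mul_rpow_of_nonneg _ _ (by positivity), hcd, ENNReal.ofReal_mul hd0]
    gcongr
    exact QE_le hN hf hfc
  have m := hmain u v φ hu huc hv hvc hφ hφc Φ hΦ
  have cu := hu.continuous_fderiv two_ne_zero
  have cv := hv.continuous_fderiv two_ne_zero
  have cw := hw.continuous_fderiv two_ne_zero
  have e : ∀ p : ℝ × Eu N, ENNReal.ofReal
        ((exp p.1 * exp (-p.1) ^ (N - 1)) * osc (fun x => u x - v x) p.1 p.2 *
        (osc u p.1 p.2 + osc v p.1 p.2) ^ (N - 1)) =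
      wtE N p * oscE (fderiv ℝ (fun x => u x - v x)) p *
        (oscE (fderiv ℝ u) p + oscE (fderiv ℝ v) p) ^ (N - 1) := by
    intro p
    have o1 := osc_nonneg u p.1 p.2
    have o2 := osc_nonneg v p.1 p.2
    have o3 := osc_nonneg (fun x => u x - v x) p.1 p.2
    rw [ENNReal.ofReal_mul (by positivity), ENNReal.ofReal_mul (by positivity),
      ENNReal.ofReal_pow (by positivity), ENNReal.ofReal_add o1 o2, ofReal_osc cu, ofReal_osc cv,
      ofReal_osc cw]
    rfl
  simp_rw [e] at m
  have hs := holder_step hN (oscE_meas cw) (oscE_meas cu) (oscE_meas cv)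
  set bw := besov N (2 - 2 / (N : ℝ)) N (fun x => u x - v x) with hbw
  set bu := besov N (2 - 2 / (N : ℝ)) N u with hbu
  set bv := besov N (2 - 2 / (N : ℝ)) N v with hbv
  have bw0 : 0 ≤ bw := besov_nonneg _ _ _ _
  have bu0 : 0 ≤ bu := besov_nonneg _ _ _ _
  have bv0 : 0 ≤ bv := besov_nonneg _ _ _ _
  have fin : ENNReal.ofReal |(∫ x, φ x * hessDet u x) - ∫ x, φ x * hessDet v x| ≤
      ENNReal.ofReal (K * Φ * ((d * bw) * (d * bu + d * bv) ^ (N - 1))) := by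
    refine m.trans ?_
    rw [ENNReal.ofReal_mul (p := K * Φ) (by positivity)]
    refine mul_le_mul_right (hs.trans ?_) _
    rw [ENNReal.ofReal_mul (by positivity), ENNReal.ofReal_pow (by positivity),
      ENNReal.ofReal_add (by positivity) (by positivity)]
    gcongr
    · exact key _ hw hwc
    · exact key _ hu huc
    · exact key _ hv hvc
  refine ((ENNReal.ofReal_le_ofReal_iff (by positivity)).1 fin).trans (le_of_eq ?_)
  rw [← mul_add, mul_pow]
  ring

lemma add_pow_crude {a b : ℝ} (ha : 0 ≤ a) (hb : 0 ≤ b) (n : ℕ) :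
    (a + b) ^ n ≤ 2 ^ n * (a ^ n + b ^ n) := by
  rcases le_total a b with h | h
  · calc (a + b) ^ n ≤ (2 * b) ^ n := by
          gcongr
          linarith
      _ = 2 ^ n * b ^ n := mul_pow _ _ _
      _ ≤ 2 ^ n * (a ^ n + b ^ n) := by
          gcongr
          have : 0 ≤ a ^ n := by positivity
          linarith
  · calc (a + b) ^ n ≤ (2 * a) ^ n := by
          gcongr
          linarith
      _ = 2 ^ n * a ^ n := mul_pow _ _ _
      _ ≤ 2 ^ n * (a ^ n + b ^ n) := by
          gcongr
          have : 0 ≤ b ^ n := by positivity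
          linarith

end Part8

/-- Theorem 1: `B(2-2/N, N)` stability of the Hessian determinant. -/
theorem stmt0 (N : ℕ) (hN : 3 ≤ N) :
    ∃ C : ℝ, 0 < C ∧
      ∀ u₁ u₂ φ : Eu N → ℝ,
        ContDiff ℝ 2 u₁ → HasCompactSupport u₁ →
        ContDiff ℝ 2 u₂ → HasCompactSupport u₂ →
        ContDiff ℝ 2 φ → HasCompactSupport φ →
        |∫ x : Eu N, (hessDet u₁ x - hessDet u₂ x) * φ x| ≤
          C * besov N (2 - 2/(N:ℝ)) N (fun x => u₁ x - u₂ x) *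
            (besov N (2 - 2/(N:ℝ)) N u₁ ^ (N-1) + besov N (2 - 2/(N:ℝ)) N u₂ ^ (N-1)) *
            (⨆ x : Eu N, ‖iteratedFDeriv ℝ 2 φ x‖) := by
  obtain ⟨K, hK, hest⟩ := real_est hN
  refine ⟨K * 2 ^ (N - 1) + 1, by positivity, ?_⟩
  intro u v φ hu huc hv hvc hφ hφc
  have hb := iter_bdd hφ hφc
  have hΦ0 : 0 ≤ ⨆ x : Eu N, ‖iteratedFDeriv ℝ 2 φ x‖ := Real.iSup_nonneg fun x => norm_nonneg _
  have h := hest u v φ hu huc hv hvc hφ hφc (⨆ x : Eu N, ‖iteratedFDeriv ℝ 2 φ x‖) hΦ0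
    (fun i j x => (pd2_le_iter hφ i j x).trans (le_ciSup hb x))
  have int : ∀ w : Eu N → ℝ, ContDiff ℝ 2 w → Integrable (fun x => φ x * hessDet w x) := by
    intro w hw
    exact (hφ.continuous.mul (hessDet_cont hw)).integrable_of_hasCompactSupport hφc.mul_right
  have e : ∫ x : Eu N, (hessDet u x - hessDet v x) * φ x =
      (∫ x, φ x * hessDet u x) - ∫ x, φ x * hessDet v x := by
    rw [← integral_sub (int u hu) (int v hv)]
    refine integral_congr_ae (Eventually.of_forall fun x => ?_)
    simp only
    ring
  rw [e]
  refine h.trans ?_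
  have bw0 := besov_nonneg N (2 - 2 / (N : ℝ)) N (fun x => u x - v x)
  have bu0 := besov_nonneg N (2 - 2 / (N : ℝ)) N u
  have bv0 := besov_nonneg N (2 - 2 / (N : ℝ)) N v
  have ac := add_pow_crude bu0 bv0 (N - 1)
  refine mul_le_mul_of_nonneg_right ?_ hΦ0
  refine (mul_le_mul_of_nonneg_left ac (by positivity)).trans ?_
  set bw := besov N (2 - 2 / (N : ℝ)) N (fun x => u x - v x)
  set S := besov N (2 - 2 / (N : ℝ)) N u ^ (N - 1) + besov N (2 - 2 / (N : ℝ)) N v ^ (N - 1) with hS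
  have hS0 : 0 ≤ S := by positivity
  have : 0 ≤ bw * S := by positivity
  nlinarith
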